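/- arXiv:1409.2971 — 3 statements merged into one kernel-verified Lean document; each statement's English description precedes it below -/
import Mathlib

section
/- For every z ∈ ℂ that is not a nonpositive integer, ψ_G(z)/Γ(z) = e^{(2γ + (1/2)log(2π) − 1/2)·z} · ∏_{k=0}^∞ (1 − z/β_k) e^{z/β_k}, where the infinite product converges. -/
/-- The logarithmic derivative `ψ_G = G'/G` of the Barnes `G` function, expressed via the
Digamma function `ψ = Γ'/Γ` as `ψ_G(z) = (log 2π + 1)/2 - z + (z-1)ψ(z)`. -/
noncomputable def psiG (z : ℂ) : ℂ :=
  ((Real.log (2 * Real.pi) : ℂ) + 1) / 2 - z + (z - 1) * logDeriv Complex.Gamma z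

open Filter Topology Polynomial

/-- Deviation from `1` of a perturbed Weierstrass elementary factor. -/
lemma norm_one_add_mul_exp_neg_sub_one_le (w v : ℂ) (hv : ‖v‖ ≤ 1) :
    ‖(1 + w) * Complex.exp (-v) - 1‖ ≤ (1 + ‖w‖) * ‖v‖ ^ 2 + ‖w - v‖ + ‖w‖ * ‖v‖ := by
  have h : ‖Complex.exp (-v) - 1 - (-v)‖ ≤ ‖v‖ ^ 2 := by
    simpa using Complex.norm_exp_sub_one_sub_id_le (x := -v) (by simpa using hv)
  calc ‖(1 + w) * Complex.exp (-v) - 1‖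
      = ‖(1 + w) * (Complex.exp (-v) - 1 - (-v)) + (w - v) - w * v‖ := by congr 1; ring
    _ ≤ ‖(1 + w) * (Complex.exp (-v) - 1 - (-v))‖ + ‖w - v‖ + ‖w * v‖ :=
        (norm_sub_le _ _).trans (by gcongr; exact norm_add_le _ _)
    _ ≤ (1 + ‖w‖) * ‖v‖ ^ 2 + ‖w - v‖ + ‖w‖ * ‖v‖ := by
        rw [norm_mul, norm_mul]
        gcongr
        exact (norm_add_le _ _).trans (by simp)

/-- The Weierstrass elementary factor of genus one with zero `x`. -/
noncomputable def elemFactor (z : ℂ) (x : ℝ) : ℂ :=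
  (1 - z / (x : ℂ)) * Complex.exp (z / (x : ℂ))

lemma norm_elemFactor_sub_one_le {z : ℂ} {x r : ℝ} (hr : 0 < r) (hz : ‖z‖ ≤ r) (hx : r ≤ |x|) :
    ‖elemFactor z x - 1‖ ≤ 3 * ‖z‖ ^ 2 / r ^ 2 := by
  set w : ℂ := -(z / x) with hw
  have hw1 : ‖w‖ ≤ ‖z‖ / r := by
    rw [hw, norm_neg, norm_div, Complex.norm_real, Real.norm_eq_abs]
    gcongr
  have hw2 : ‖w‖ ≤ 1 := hw1.trans ((div_le_one hr).2 hz)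
  have h := norm_one_add_mul_exp_neg_sub_one_le w w hw2
  have he : elemFactor z x = (1 + w) * Complex.exp (-w) := by simp [elemFactor, hw, sub_eq_add_neg]
  rw [he]
  calc _ ≤ _ := h
    _ ≤ 3 * ‖w‖ ^ 2 := by
      rw [sub_self, norm_zero]
      nlinarith [sq_nonneg ‖w‖, norm_nonneg w]
    _ ≤ 3 * (‖z‖ / r) ^ 2 := by gcongr
    _ = _ := by ring

lemma summable_div_sub_two_sq (c : ℝ) : Summable fun k : ℕ => c / ((k : ℝ) - 2) ^ 2 := by
  rw [← summable_nat_add_iff 2]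
  simpa [div_eq_mul_inv] using (Real.summable_nat_pow_inv.2 one_lt_two).mul_left c

lemma norm_elemFactor_sub_one_le_of_lt {z : ℂ} {x : ℝ} {k : ℕ} (hk : ‖z‖ + 2 < k)
    (hx : (k : ℝ) - 2 ≤ |x|) : ‖elemFactor z x - 1‖ ≤ 3 * ‖z‖ ^ 2 / ((k : ℝ) - 2) ^ 2 :=
  norm_elemFactor_sub_one_le (by linarith [norm_nonneg z]) (by linarith) hx

lemma summable_norm_elemFactor_sub_one (z : ℂ) {y : ℕ → ℝ} (hy : ∀ k : ℕ, (k : ℝ) - 2 ≤ |y k|) :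
    Summable fun k => ‖elemFactor z (y k) - 1‖ := by
  refine (summable_div_sub_two_sq (3 * ‖z‖ ^ 2)).of_norm_bounded_eventually_nat ?_
  filter_upwards [tendsto_natCast_atTop_atTop.eventually_gt_atTop (‖z‖ + 2)] with k hk
  simpa using norm_elemFactor_sub_one_le_of_lt hk (hy k)

lemma multipliable_elemFactor (z : ℂ) {y : ℕ → ℝ} (hy : ∀ k : ℕ, (k : ℝ) - 2 ≤ |y k|) :
    Multipliable fun k => elemFactor z (y k) := by
  simpa using multipliable_one_add_of_summable (summable_norm_elemFactor_sub_one z hy)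

lemma tprod_elemFactor_ne_zero {z : ℂ} {y : ℕ → ℝ} (hy : ∀ k : ℕ, (k : ℝ) - 2 ≤ |y k|)
    (hz : ∀ k, elemFactor z (y k) ≠ 0) : ∏' k, elemFactor z (y k) ≠ 0 := by
  simpa using tprod_one_add_ne_zero_of_summable (f := fun k => elemFactor z (y k) - 1)
    (by simpa using hz) (summable_norm_elemFactor_sub_one z hy)

/-- Finite genus-one products converge to the infinite one when their zeros converge. -/
lemma tendsto_prod_elemFactor (z : ℂ) {u : ℕ → ℕ → ℝ} {y : ℕ → ℝ} {N : ℕ → ℕ}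
    (hN : Tendsto N atTop atTop) (hu : ∀ k, Tendsto (fun n => u n k) atTop (𝓝 (y k)))
    (hy0 : ∀ k, y k ≠ 0) (hub : ∀ n k : ℕ, (k : ℝ) - 2 ≤ |u n k|) :
    Tendsto (fun n => ∏ k ∈ Finset.range (N n), elemFactor z (u n k)) atTop
      (𝓝 (∏' k, elemFactor z (y k))) := by
  set f : ℕ → ℕ → ℂ := fun n k => if k < N n then elemFactor z (u n k) - 1 else 0 with hf
  have hlim (k : ℕ) : Tendsto (f · k) atTop (𝓝 (elemFactor z (y k) - 1)) := by
    have hdiv : Tendsto (fun n => z / (u n k : ℂ)) atTop (𝓝 (z / (y k : ℂ))) :=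
      tendsto_const_nhds.div ((Complex.continuous_ofReal.tendsto _).comp (hu k))
        (by exact_mod_cast hy0 k)
    have h : Tendsto (fun n => elemFactor z (u n k) - 1) atTop (𝓝 (elemFactor z (y k) - 1)) :=
      (((tendsto_const_nhds.sub hdiv).mul
        ((Complex.continuous_exp.tendsto _).comp hdiv))).sub_const 1
    refine h.congr' ?_
    filter_upwards [hN.eventually_gt_atTop k] with n hn
    simp [hf, hn]
  obtain ⟨K, hK⟩ := exists_nat_gt (‖z‖ + 2)
  set b : ℕ → ℝ := fun k =>
    (if k < K then ‖elemFactor z (y k) - 1‖ + 1 else 0) + 3 * ‖z‖ ^ 2 / ((k : ℝ) - 2) ^ 2 with hb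
  have hbs : Summable b := by
    refine Summable.add (summable_of_hasFiniteSupport ?_) (summable_div_sub_two_sq _)
    refine (Set.finite_lt_nat K).subset fun k hk => ?_
    by_contra hkK
    exact hk (if_neg hkK)
  have hbound : ∀ᶠ n in atTop, ∀ k, ‖f n k‖ ≤ b k := by
    have hsmall : ∀ᶠ n in atTop, ∀ k ∈ Finset.range K, ‖f n k‖ < ‖elemFactor z (y k) - 1‖ + 1 :=
      (Finset.eventually_all _).2 fun k _ =>
        (hlim k).norm.eventually_lt_const (lt_add_one _)
    filter_upwards [hsmall] with n hn k
    by_cases hkK : k < K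
    · have := (hn k (Finset.mem_range.2 hkK)).le
      simp only [hb, if_pos hkK]
      exact this.trans (le_add_of_nonneg_right (by positivity))
    · simp only [hb, if_neg hkK, zero_add, hf]
      split_ifs with hkN
      · refine norm_elemFactor_sub_one_le_of_lt (hK.trans_le ?_) (hub n k)
        exact_mod_cast not_lt.1 hkK
      · rw [norm_zero]; positivity
  have h := tendsto_tprod_one_add_of_dominated_convergence hbs hlim hbound
  simp only [add_sub_cancel] at h
  refine h.congr fun n => ?_
  rw [tprod_eq_prod (s := Finset.range (N n)) fun k hk => by simp [hf, Finset.mem_range.not.1 hk]]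
  exact Finset.prod_congr rfl fun k hk => by simp [hf, Finset.mem_range.1 hk]

/-- A real polynomial with value `1` at `0` is determined by a full set of roots. -/
lemma Polynomial.eq_prod_one_sub_of_roots {q : ℝ[X]} {m : ℕ} {x : ℕ → ℝ} (hdeg : q.natDegree ≤ m)
    (hq0 : q.eval 0 = 1) (hinj : Set.InjOn x (Finset.range m)) (hx0 : ∀ k < m, x k ≠ 0)
    (hroot : ∀ k < m, q.eval (x k) = 0) :
    q = ∏ k ∈ Finset.range m, (1 - C (x k)⁻¹ * X) := by
  classical
  set s : Finset ℝ := insert 0 ((Finset.range m).image x) with hs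
  have hcard : s.card = m + 1 := by
    rw [hs, Finset.card_insert_of_notMem, Finset.card_image_of_injOn hinj, Finset.card_range]
    simp only [Finset.mem_image, Finset.mem_range, not_exists, not_and]
    exact hx0
  have hlt {p : ℝ[X]} (hp : p.natDegree ≤ m) : p.degree < s.card := by
    rw [hcard]
    exact (natDegree_le_iff_degree_le.1 hp).trans_lt (by exact_mod_cast Nat.lt_succ_self m)
  refine eq_of_degrees_lt_of_eval_finset_eq s (hlt hdeg) (hlt ?_) ?_
  · refine (natDegree_prod_le _ _).trans ((Finset.sum_le_card_nsmul _ _ 1 fun k _ => ?_).trans ?_)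
    · compute_degree
    · simp
  · intro t ht
    rw [eval_prod]
    rcases Finset.mem_insert.1 ht with rfl | ht
    · simp [hq0]
    · obtain ⟨k, hk, rfl⟩ := Finset.mem_image.1 ht
      have hkm := Finset.mem_range.1 hk
      rw [hroot k hkm, Finset.prod_eq_zero hk]
      simp [hx0 k hkm]

lemma Polynomial.eval_zero_derivative_prod_one_sub (m : ℕ) (a : ℕ → ℝ) :
    (derivative (∏ k ∈ Finset.range m, (1 - C (a k) * X))).eval 0 =
      -∑ k ∈ Finset.range m, a k := by
  rw [derivative_prod_finset, eval_finsetSum, ← Finset.sum_neg_distrib]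
  exact Finset.sum_congr rfl fun k _ => by simp [eval_prod]

/-- The normalized rising factorial `X ∏_{j=1}^n (1 + X / j)`. -/
noncomputable def risingPoly : ℕ → ℝ[X]
  | 0 => X
  | n + 1 => risingPoly n * (1 + C ((n + 1 : ℝ)⁻¹) * X)

lemma natDegree_risingPoly_le (n : ℕ) : (risingPoly n).natDegree ≤ n + 1 := by
  induction n with
  | zero => simp [risingPoly]
  | succ n ih =>
    refine natDegree_mul_le.trans (Nat.add_le_add ih ?_)
    compute_degree

lemma eval_risingPoly_succ (n : ℕ) (x : ℝ) :
    (risingPoly (n + 1)).eval x = (risingPoly n).eval x * (1 + (n + 1 : ℝ)⁻¹ * x) := by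
  simp [risingPoly]

lemma derivative_risingPoly_succ (n : ℕ) :
    derivative (risingPoly (n + 1)) = derivative (risingPoly n) * (1 + C ((n + 1 : ℝ)⁻¹) * X) +
      risingPoly n * C ((n + 1 : ℝ)⁻¹) := by
  simp [risingPoly]

lemma eval_derivative_risingPoly_succ (n : ℕ) (x : ℝ) :
    (derivative (risingPoly (n + 1))).eval x =
      (derivative (risingPoly n)).eval x * (1 + (n + 1 : ℝ)⁻¹ * x) +
        (risingPoly n).eval x * (n + 1 : ℝ)⁻¹ := by
  simp [derivative_risingPoly_succ]

lemma eval_risingPoly_pos (n : ℕ) {x : ℝ} (hx : 0 < x) : 0 < (risingPoly n).eval x := by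
  induction n with
  | zero => simpa [risingPoly]
  | succ n ih =>
    rw [eval_risingPoly_succ]
    positivity

lemma eval_risingPoly_neg_nat {n k : ℕ} (hk : k ≤ n) : (risingPoly n).eval (-(k : ℝ)) = 0 := by
  induction n with
  | zero => simp [risingPoly, Nat.le_zero.1 hk]
  | succ n ih =>
    rw [eval_risingPoly_succ]
    rcases hk.lt_or_eq with h | rfl
    · rw [ih (Nat.lt_succ_iff.1 h), zero_mul]
    · push_cast
      rw [mul_neg, inv_mul_cancel₀ (by positivity)]
      simp

lemma sign_eval_risingPoly_neg {n : ℕ} {x : ℝ} (hx : (n : ℝ) < x) :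
    0 < (-1) ^ (n + 1) * (risingPoly n).eval (-x) := by
  induction n with
  | zero => simpa [risingPoly] using hx
  | succ n ih =>
    push_cast at hx
    have h1 : 0 < (n + 1 : ℝ)⁻¹ * x - 1 := by
      rw [sub_pos, inv_mul_eq_div, one_lt_div (by positivity)]
      exact hx
    have := mul_pos (ih (by linarith)) h1
    rw [eval_risingPoly_succ]
    exact this.trans_eq (by ring)

lemma sign_eval_derivative_risingPoly_neg_nat {n k : ℕ} (hk : k ≤ n) :
    0 < (-1) ^ k * (derivative (risingPoly n)).eval (-(k : ℝ)) := by
  induction n with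
  | zero => simp [risingPoly, Nat.le_zero.1 hk]
  | succ n ih =>
    rw [eval_derivative_risingPoly_succ]
    rcases hk.lt_or_eq with h | rfl
    · rw [eval_risingPoly_neg_nat (Nat.lt_succ_iff.1 h), zero_mul, add_zero, ← mul_assoc]
      refine mul_pos (ih (Nat.lt_succ_iff.1 h)) ?_
      rw [mul_neg, ← sub_eq_add_neg, sub_pos, inv_mul_eq_div, div_lt_one (by positivity)]
      exact_mod_cast h
    · have h0 : (1 : ℝ) + (n + 1 : ℝ)⁻¹ * (-((n + 1 : ℕ) : ℝ)) = 0 := by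
        push_cast
        rw [mul_neg, inv_mul_cancel₀ (by positivity)]
        simp
      rw [h0, mul_zero, zero_add, ← mul_assoc]
      exact mul_pos (sign_eval_risingPoly_neg (by push_cast; linarith)) (by positivity)

lemma eval_zero_risingPoly (n : ℕ) : (risingPoly n).eval 0 = 0 := by
  simpa using eval_risingPoly_neg_nat (Nat.zero_le n)

lemma eval_zero_derivative_risingPoly (n : ℕ) : (derivative (risingPoly n)).eval 0 = 1 := by
  induction n with
  | zero => simp [risingPoly]
  | succ n ih => simp [eval_derivative_risingPoly_succ, ih, eval_zero_risingPoly]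

lemma eval_zero_derivative_derivative_risingPoly (n : ℕ) :
    (derivative (derivative (risingPoly n))).eval 0 = 2 * (harmonic n : ℝ) := by
  induction n with
  | zero => simp [risingPoly]
  | succ n ih =>
    simp [derivative_risingPoly_succ, ih, eval_zero_derivative_risingPoly, harmonic_succ]
    ring

/-- Polynomial approximants of `ψ_G / Γ`, up to an exponential factor. -/
noncomputable def approxPoly (A L : ℝ) (n : ℕ) : ℝ[X] :=
  (C A - X) * risingPoly n + (1 - X) * (derivative (risingPoly n) - C L * risingPoly n)

lemma natDegree_approxPoly_le (A L : ℝ) (n : ℕ) : (approxPoly A L n).natDegree ≤ n + 2 := by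
  have hP := natDegree_risingPoly_le n
  have hD : (derivative (risingPoly n)).natDegree ≤ n + 1 :=
    (natDegree_derivative_le _).trans (by lia)
  refine (natDegree_add_le_of_degree_le (n := n + 2) ?_ ?_)
  · refine natDegree_mul_le.trans ((Nat.add_le_add (b := 1) ?_ hP).trans (by lia))
    compute_degree
  · refine natDegree_mul_le.trans ((Nat.add_le_add (b := 1) (d := n + 1) ?_ ?_).trans (by lia))
    · compute_degree
    · simpa using natDegree_sub_le_of_le hD ((natDegree_C_mul_le L _).trans hP)

lemma eval_zero_approxPoly (A L : ℝ) (n : ℕ) : (approxPoly A L n).eval 0 = 1 := by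
  simp [approxPoly, eval_zero_risingPoly, eval_zero_derivative_risingPoly]

lemma eval_zero_derivative_approxPoly (A L : ℝ) (n : ℕ) :
    (derivative (approxPoly A L n)).eval 0 = A - 1 + 2 * harmonic n - L := by
  simp [approxPoly, eval_zero_risingPoly, eval_zero_derivative_risingPoly,
    eval_zero_derivative_derivative_risingPoly]
  ring

lemma eval_one_approxPoly_pos {A : ℝ} (hA : 1 < A) (L : ℝ) (n : ℕ) :
    0 < (approxPoly A L n).eval 1 := by
  simpa [approxPoly] using mul_pos (sub_pos.2 hA) (eval_risingPoly_pos n one_pos)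

lemma sign_eval_approxPoly_neg_nat (A L : ℝ) {n k : ℕ} (hk : k ≤ n) :
    0 < (-1) ^ k * (approxPoly A L n).eval (-(k : ℝ)) := by
  have := mul_pos (sign_eval_derivative_risingPoly_neg_nat hk) (show (0 : ℝ) < 1 + k by positivity)
  simp only [approxPoly, eval_add, eval_mul, eval_sub, eval_C, eval_X, eval_one,
    eval_risingPoly_neg_nat hk]
  exact this.trans_eq (by ring)

/-- Left ends of the intervals isolating the zeros of `ψ_G`. -/
def zeroLower : ℕ → ℝ
  | 0 => 1
  | 1 => 2
  | k + 2 => -(k + 1)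

/-- Right ends of the intervals isolating the zeros of `ψ_G`. -/
def zeroUpper : ℕ → ℝ
  | 0 => 2
  | 1 => 4
  | k + 2 => -k

lemma zeroLower_lt_zeroUpper : ∀ k, zeroLower k < zeroUpper k
  | 0 => by norm_num [zeroLower, zeroUpper]
  | 1 => by norm_num [zeroLower, zeroUpper]
  | k + 2 => by simp [zeroLower, zeroUpper]

lemma eq_of_mem_Ioo_zeroLower_zeroUpper {x : ℝ} : ∀ {j k : ℕ},
    x ∈ Set.Ioo (zeroLower j) (zeroUpper j) → x ∈ Set.Ioo (zeroLower k) (zeroUpper k) → j = k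
  | 0, 0, _, _ => rfl
  | 0, 1, h, h' => by simp only [zeroLower, zeroUpper, Set.mem_Ioo] at h h'; linarith
  | 1, 0, h, h' => by simp only [zeroLower, zeroUpper, Set.mem_Ioo] at h h'; linarith
  | 1, 1, _, _ => rfl
  | 0, k + 2, h, h' => by
    simp only [zeroLower, zeroUpper, Set.mem_Ioo] at h h'
    linarith [k.cast_nonneg (α := ℝ)]
  | 1, k + 2, h, h' => by
    simp only [zeroLower, zeroUpper, Set.mem_Ioo] at h h'
    linarith [k.cast_nonneg (α := ℝ)]
  | j + 2, 0, h, h' => by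
    simp only [zeroLower, zeroUpper, Set.mem_Ioo] at h h'
    linarith [j.cast_nonneg (α := ℝ)]
  | j + 2, 1, h, h' => by
    simp only [zeroLower, zeroUpper, Set.mem_Ioo] at h h'
    linarith [j.cast_nonneg (α := ℝ)]
  | j + 2, k + 2, h, h' => by
    simp only [zeroLower, zeroUpper, Set.mem_Ioo] at h h'
    have h1 : (j : ℝ) < k + 1 := by linarith
    have h2 : (k : ℝ) < j + 1 := by linarith
    norm_cast at h1 h2
    lia

lemma ne_zero_of_mem_Ioo_zeroLower_zeroUpper {x : ℝ} {k : ℕ}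
    (hx : x ∈ Set.Ioo (zeroLower k) (zeroUpper k)) : x ≠ 0 := by
  rintro rfl
  match k, hx with
  | 0, hx => norm_num [zeroLower] at hx
  | 1, hx => norm_num [zeroLower] at hx
  | k + 2, hx =>
    simp only [zeroUpper, Set.mem_Ioo] at hx
    linarith [k.cast_nonneg (α := ℝ)]

lemma sub_two_le_abs_of_mem_Icc {x : ℝ} {k : ℕ}
    (hx : x ∈ Set.Icc (zeroLower k) (zeroUpper k)) : (k : ℝ) - 2 ≤ |x| := by
  match k, hx with
  | 0, hx => push_cast; linarith [abs_nonneg x]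
  | 1, hx => push_cast; linarith [abs_nonneg x]
  | k + 2, hx =>
    have := hx.2
    simp only [zeroUpper] at this
    push_cast
    linarith [neg_le_abs x]

lemma eval_approxPoly_zeroLower_mul_zeroUpper_neg {A L : ℝ} {n : ℕ} (hA : 1 < A)
    (h2 : (approxPoly A L n).eval 2 < 0) (h4 : 0 < (approxPoly A L n).eval 4) {k : ℕ}
    (hk : k < n + 2) :
    (approxPoly A L n).eval (zeroLower k) * (approxPoly A L n).eval (zeroUpper k) < 0 := by
  match k, hk with
  | 0, _ => exact mul_neg_of_pos_of_neg (eval_one_approxPoly_pos hA L n) h2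
  | 1, _ => exact mul_neg_of_neg_of_pos h2 h4
  | k + 2, hk =>
    have hl := sign_eval_approxPoly_neg_nat A L (show k + 1 ≤ n by lia)
    have hu := sign_eval_approxPoly_neg_nat A L (show k ≤ n by lia)
    have h := mul_pos hl hu
    push_cast at h
    have hs : ((-1 : ℝ) ^ k) ^ 2 = 1 := by rw [← pow_mul, mul_comm, pow_mul]; simp
    simp only [zeroLower, zeroUpper]
    rw [pow_succ] at h
    linear_combination h - (approxPoly A L n).eval (-((k : ℝ) + 1)) *
      (approxPoly A L n).eval (-(k : ℝ)) * hs

lemma exists_root_approxPoly {A L : ℝ} {n : ℕ} (hA : 1 < A)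
    (h2 : (approxPoly A L n).eval 2 < 0) (h4 : 0 < (approxPoly A L n).eval 4) {k : ℕ}
    (hk : k < n + 2) :
    ∃ x ∈ Set.Ioo (zeroLower k) (zeroUpper k), (approxPoly A L n).eval x = 0 := by
  have h := eval_approxPoly_zeroLower_mul_zeroUpper_neg hA h2 h4 hk
  have hc := (approxPoly A L n).continuousOn (s := Set.Icc (zeroLower k) (zeroUpper k))
  have hle := (zeroLower_lt_zeroUpper k).le
  rcases mul_neg_iff.1 h with ⟨ha, hb⟩ | ⟨ha, hb⟩
  · exact intermediate_value_Ioo' hle hc ⟨hb, ha⟩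
  · exact intermediate_value_Ioo hle hc ⟨ha, hb⟩

/-- Factorization of the approximants over their roots, written with elementary factors. -/
lemma aeval_approxPoly_eq_prod {A L : ℝ} {n : ℕ} {x : ℕ → ℝ}
    (hx : ∀ k < n + 2, x k ∈ Set.Ioo (zeroLower k) (zeroUpper k))
    (hroot : ∀ k < n + 2, (approxPoly A L n).eval (x k) = 0) (z : ℂ) :
    aeval z (approxPoly A L n) = Complex.exp (((A - 1 + 2 * harmonic n - L : ℝ) : ℂ) * z) *
      ∏ k ∈ Finset.range (n + 2), elemFactor z (x k) := by
  have hinj : Set.InjOn x (Finset.range (n + 2)) := fun j hj k hk hjk =>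
    eq_of_mem_Ioo_zeroLower_zeroUpper (hx j (Finset.mem_range.1 hj))
      (hjk ▸ hx k (Finset.mem_range.1 hk))
  have hfac := eq_prod_one_sub_of_roots (natDegree_approxPoly_le A L n) (eval_zero_approxPoly A L n)
    hinj (fun k hk => ne_zero_of_mem_Ioo_zeroLower_zeroUpper (hx k hk)) hroot
  have hder : A - 1 + 2 * harmonic n - L = -∑ k ∈ Finset.range (n + 2), (x k)⁻¹ := by
    rw [← eval_zero_derivative_approxPoly, hfac, eval_zero_derivative_prod_one_sub]
  rw [hder, hfac]
  simp only [elemFactor, Finset.prod_mul_distrib, ← Complex.exp_sum, map_prod, map_sub, map_one,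
    map_mul, aeval_C, aeval_X]
  rw [mul_left_comm, ← Complex.exp_add]
  push_cast
  rw [neg_mul, Finset.sum_mul, ← Finset.sum_neg_distrib, ← Finset.sum_add_distrib,
    Finset.sum_eq_zero (fun k _ => by ring), Complex.exp_zero, mul_one]
  exact Finset.prod_congr rfl fun k _ => by simp [div_eq_inv_mul]

/-- Factors of Euler's product for `1 / Γ`, minus one. -/
noncomputable def invGammaFactor : ℕ → ℂ → ℂ
  | 0, z => z - 1
  | j + 1, z =>
    (1 + z * ((j + 1 : ℝ)⁻¹ : ℝ)) *
      Complex.exp (-(z * ((Real.log (j + 2) - Real.log (j + 1) : ℝ) : ℂ))) - 1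

lemma continuous_invGammaFactor : ∀ j, Continuous (invGammaFactor j)
  | 0 => by unfold invGammaFactor; fun_prop
  | j + 1 => by unfold invGammaFactor; fun_prop

/-- Euler's partial products for `1 / Γ`. -/
noncomputable def approxInvGamma (n : ℕ) (z : ℂ) : ℂ :=
  aeval z (risingPoly n) * Complex.exp (-(z * (Real.log (n + 1) : ℂ)))

lemma prod_invGammaFactor (n : ℕ) (z : ℂ) :
    ∏ j ∈ Finset.range (n + 1), (1 + invGammaFactor j z) = approxInvGamma n z := by
  induction n with
  | zero => simp [invGammaFactor, approxInvGamma, risingPoly]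
  | succ n ih =>
    rw [Finset.prod_range_succ, ih]
    simp only [approxInvGamma, invGammaFactor, risingPoly, add_sub_cancel, map_mul, map_add,
      map_one, aeval_C, aeval_X, Nat.cast_add, Nat.cast_one, add_assoc, one_add_one_eq_two]
    rw [mul_mul_mul_comm, ← Complex.exp_add]
    congr 2
    · simp [mul_comm]
    · push_cast; ring

lemma norm_invGammaFactor_succ_le {z : ℂ} {r : ℝ} (hz : ‖z‖ ≤ r) {j : ℕ} (hj : r ≤ j + 1) :
    ‖invGammaFactor (j + 1) z‖ ≤ (3 * r ^ 2 + r) / ((j : ℝ) + 1) ^ 2 := by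
  set t : ℝ := (j + 1 : ℝ)⁻¹ with ht
  set l : ℝ := Real.log (j + 2) - Real.log (j + 1) with hl
  have hr : 0 ≤ r := (norm_nonneg z).trans hz
  have htpos : 0 < t := by positivity
  have hlt : l ≤ t := by
    have := Real.log_le_sub_one_of_pos (show (0 : ℝ) < (j + 2) / (j + 1) by positivity)
    rw [Real.log_div (by positivity) (by positivity)] at this
    refine this.trans_eq ?_
    rw [ht]
    field_simp
    ring
  have htl : t - t ^ 2 ≤ l := by
    have := Real.log_le_sub_one_of_pos (show (0 : ℝ) < (j + 1) / (j + 2) by positivity)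
    rw [Real.log_div (by positivity) (by positivity)] at this
    have h2 : t - t ^ 2 ≤ 1 - (j + 1 : ℝ) / (j + 2) := by
      rw [ht, ← sub_nonneg]
      have : 1 - (j + 1 : ℝ) / (j + 2) - ((j + 1 : ℝ)⁻¹ - (j + 1 : ℝ)⁻¹ ^ 2) =
          1 / ((j + 1) ^ 2 * (j + 2)) := by
        field_simp
        ring
      rw [this]
      positivity
    linarith
  have hl0 : 0 ≤ l := sub_nonneg.2 (Real.log_le_log (by positivity) (by linarith))
  have hrt : r * t ≤ 1 := by
    rw [ht, ← div_eq_mul_inv]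
    exact (div_le_one (by positivity)).2 hj
  have hw : ‖z * (t : ℂ)‖ ≤ r * t := by
    rw [norm_mul, Complex.norm_real, Real.norm_of_nonneg htpos.le]
    gcongr
  have hv : ‖z * (l : ℂ)‖ ≤ r * t := by
    rw [norm_mul, Complex.norm_real, Real.norm_of_nonneg hl0]
    gcongr
  have hwv : ‖z * (t : ℂ) - z * (l : ℂ)‖ ≤ r * t ^ 2 := by
    rw [← mul_sub, ← Complex.ofReal_sub, norm_mul, Complex.norm_real,
      Real.norm_of_nonneg (by linarith)]
    gcongr
    linarith
  calc ‖invGammaFactor (j + 1) z‖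
      ≤ (1 + ‖z * (t : ℂ)‖) * ‖z * (l : ℂ)‖ ^ 2 + ‖z * (t : ℂ) - z * (l : ℂ)‖ +
          ‖z * (t : ℂ)‖ * ‖z * (l : ℂ)‖ :=
        norm_one_add_mul_exp_neg_sub_one_le _ _ (hv.trans hrt)
    _ ≤ (1 + 1) * (r * t) ^ 2 + r * t ^ 2 + (r * t) * (r * t) := by
        gcongr
        exact hw.trans hrt
    _ = (3 * r ^ 2 + r) / ((j : ℝ) + 1) ^ 2 := by
        rw [ht]
        field_simp
        ring

lemma tendsto_approxInvGamma (z : ℂ) :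
    Tendsto (fun n => approxInvGamma n z) atTop (𝓝 (Complex.Gamma z)⁻¹) := by
  by_cases hz : ∃ m : ℕ, z = -m
  · obtain ⟨m, rfl⟩ := hz
    rw [Complex.Gamma_neg_nat_eq_zero, inv_zero]
    refine tendsto_const_nhds.congr' ?_
    filter_upwards [eventually_ge_atTop m] with n hn
    have h := eval_risingPoly_neg_nat hn
    rw [approxInvGamma, show (-(m : ℂ)) = algebraMap ℝ ℂ (-(m : ℝ)) by simp,
      aeval_algebraMap_apply, coe_aeval_eq_eval, h]
    simp
  · push Not at hz
    have h1 := ((Complex.GammaSeq_tendsto_Gamma z).comp (tendsto_add_atTop_nat 1)).inv₀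
      (Complex.Gamma_ne_zero hz)
    have h2 : Tendsto (fun n : ℕ => 1 + z * (1 / ((n : ℂ) + 1))) atTop (𝓝 1) := by
      simpa using (tendsto_one_div_add_atTop_nhds_zero_nat (𝕜 := ℂ)).const_mul z |>.const_add 1
    have h3 := h1.div h2 one_ne_zero
    rw [div_one] at h3
    refine h3.congr fun n => ?_
    have hprod (n : ℕ) : ∏ j ∈ Finset.range (n + 1), (z + j) =
        n.factorial * aeval z (risingPoly n) := by
      induction n with
      | zero => simp [risingPoly]
      | succ n ih =>
        rw [Finset.prod_range_succ, ih, Nat.factorial_succ]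
        have : (n + 1 : ℂ) ≠ 0 := by exact_mod_cast n.succ_ne_zero
        simp [risingPoly]
        field_simp
        ring
    have hn : (n + 1 : ℂ) ≠ 0 := by exact_mod_cast n.succ_ne_zero
    have hne : 1 + z * (1 / ((n : ℂ) + 1)) ≠ 0 := by
      intro h
      refine hz (n + 1) ?_
      field_simp at h
      push_cast
      linear_combination h
    have hfac : ((n + 1).factorial : ℂ) ≠ 0 := by exact_mod_cast Nat.factorial_ne_zero _
    simp only [Pi.div_apply, Function.comp_apply, Complex.GammaSeq, hprod, approxInvGamma,
      risingPoly]
    rw [Complex.cpow_def_of_ne_zero (by exact_mod_cast n.succ_ne_zero), Complex.exp_neg,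
      Complex.ofReal_log (by positivity)]
    have he := Complex.exp_ne_zero (Complex.log ((n + 1 : ℕ) : ℂ) * z)
    have haeval : aeval z (1 + C ((n + 1 : ℝ)⁻¹) * X) = 1 + z * (1 / ((n : ℂ) + 1)) := by
      rw [map_add, map_mul, map_one, aeval_C, aeval_X, mul_comm]
      simp
    rw [map_mul, haeval, inv_div]
    push_cast at he ⊢
    rw [mul_comm z (Complex.log _)]
    have hne' : (n : ℂ) + 1 + z ≠ 0 := fun h => hz (n + 1) (by push_cast; linear_combination h)
    field_simp

lemma tendstoLocallyUniformlyOn_approxInvGamma (r : ℝ) :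
    TendstoLocallyUniformlyOn approxInvGamma (fun z => (Complex.Gamma z)⁻¹) atTop
      (Metric.ball 0 r) := by
  have hsum : Summable fun j : ℕ => (3 * r ^ 2 + r) / (j : ℝ) ^ 2 := by
    simpa [div_eq_mul_inv] using (Real.summable_nat_pow_inv.2 one_lt_two).mul_left (3 * r ^ 2 + r)
  have hbound : ∀ᶠ j : ℕ in atTop, ∀ z ∈ Metric.ball (0 : ℂ) r,
      ‖invGammaFactor j z‖ ≤ (3 * r ^ 2 + r) / (j : ℝ) ^ 2 := by
    filter_upwards [tendsto_natCast_atTop_atTop.eventually_ge_atTop r, eventually_ge_atTop 1]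
      with j hj hj1 z hz
    obtain ⟨j, rfl⟩ := Nat.exists_eq_add_of_le' hj1
    push_cast at hj ⊢
    exact norm_invGammaFactor_succ_le (mem_ball_zero_iff.1 hz).le hj
  have h := (hsum.hasProdLocallyUniformlyOn_nat_one_add Metric.isOpen_ball hbound
    fun j => (continuous_invGammaFactor j).continuousOn).tendstoLocallyUniformlyOn_finsetRange
  have h' : TendstoLocallyUniformlyOn approxInvGamma (fun z => ∏' j, (1 + invGammaFactor j z))
      atTop (Metric.ball 0 r) := fun u hu x hx => by
    obtain ⟨t, ht, H⟩ := h u hu x hx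
    refine ⟨t, ht, ((tendsto_add_atTop_nat 1).eventually H).mono fun n hn y hy => ?_⟩
    simpa only [prod_invGammaFactor] using hn y hy
  exact h'.congr_right fun z hz =>
    tendsto_nhds_unique (h'.tendsto_at hz) (tendsto_approxInvGamma z)

lemma hasDerivAt_approxInvGamma (n : ℕ) (z : ℂ) :
    HasDerivAt (approxInvGamma n)
      (aeval z (derivative (risingPoly n) - C (Real.log (n + 1)) * risingPoly n) *
        Complex.exp (-(z * (Real.log (n + 1) : ℂ)))) z := by
  have h := ((risingPoly n).hasDerivAt_aeval z).mul
    (((hasDerivAt_id z).mul_const (Real.log (n + 1) : ℂ)).neg.cexp)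
  refine h.congr_deriv ?_
  simp
  ring

/-- The entire function extending `ψ_G / Γ`. -/
noncomputable def psiGDivGamma (z : ℂ) : ℂ :=
  (((Real.log (2 * Real.pi) + 1) / 2 : ℝ) - z) * (Complex.Gamma z)⁻¹ +
    (1 - z) * deriv (fun s => (Complex.Gamma s)⁻¹) z

/-- The approximants of `ψ_G / Γ` converge continuously. -/
lemma tendsto_approxPoly_mul_exp {ι : Type*} {l : Filter ι} {φ : ι → ℕ} {u : ι → ℂ} {y : ℂ}
    (hφ : Tendsto φ l atTop) (hu : Tendsto u l (𝓝 y)) :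
    Tendsto (fun i => aeval (u i)
        (approxPoly ((Real.log (2 * Real.pi) + 1) / 2) (Real.log (φ i + 1)) (φ i)) *
        Complex.exp (-(u i * (Real.log (φ i + 1) : ℂ)))) l (𝓝 (psiGDivGamma y)) := by
  have hy : y ∈ Metric.ball (0 : ℂ) (‖y‖ + 1) := by simp
  have hopen := Metric.isOpen_ball (x := (0 : ℂ)) (ε := ‖y‖ + 1)
  have hT := tendstoLocallyUniformlyOn_approxInvGamma (‖y‖ + 1)
  have hdiff : Differentiable ℂ fun s : ℂ => (Complex.Gamma s)⁻¹ :=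
    Complex.differentiable_one_div_Gamma
  have hT' := hT.deriv (Eventually.of_forall fun n z _ =>
    (hasDerivAt_approxInvGamma n z).differentiableAt.differentiableWithinAt) hopen
  have hu' : Tendsto u l (𝓝[Metric.ball 0 (‖y‖ + 1)] y) :=
    tendsto_nhdsWithin_iff.2 ⟨hu, hu.eventually (hopen.mem_nhds hy)⟩
  have hsub {F : ℕ → ℂ → ℂ} {f : ℂ → ℂ}
      (hF : TendstoLocallyUniformlyOn F f atTop (Metric.ball 0 (‖y‖ + 1))) :
      TendstoLocallyUniformlyOn (fun i => F (φ i)) f l (Metric.ball 0 (‖y‖ + 1)) :=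
    fun v hv x hx => (hF v hv x hx).imp fun t ht => ⟨ht.1, hφ.eventually ht.2⟩
  have h1 := (hsub hT).tendsto_comp hdiff.continuous.continuousWithinAt hy hu'
  have h2 := (hsub hT').tendsto_comp
    (hdiff.contDiff (n := 1)).continuous_deriv_one.continuousWithinAt hy hu'
  have h3 := ((tendsto_const_nhds (x := (((Real.log (2 * Real.pi) + 1) / 2 : ℝ) : ℂ))).sub hu).mul
    h1 |>.add (((tendsto_const_nhds (x := (1 : ℂ))).sub hu).mul h2)
  refine h3.congr fun i => ?_
  simp only [Function.comp_apply, (hasDerivAt_approxInvGamma _ _).deriv, approxInvGamma, approxPoly,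
    map_add, map_mul, map_sub, map_one, aeval_C, aeval_X, Complex.coe_algebraMap]
  ring

lemma deriv_inv_Gamma {z : ℂ} (hz : ∀ n : ℕ, z ≠ -(n : ℂ)) :
    deriv (fun s => (Complex.Gamma s)⁻¹) z = -deriv Complex.Gamma z / Complex.Gamma z ^ 2 :=
  ((Complex.differentiableAt_Gamma z hz).hasDerivAt.inv (Complex.Gamma_ne_zero hz)).deriv

lemma psiG_div_Gamma_eq {z : ℂ} (hz : ∀ n : ℕ, z ≠ -(n : ℂ)) :
    psiG z / Complex.Gamma z = psiGDivGamma z := by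
  have hG := Complex.Gamma_ne_zero hz
  rw [psiGDivGamma, deriv_inv_Gamma hz, psiG, logDeriv_apply]
  push_cast
  field_simp
  ring

lemma psiGDivGamma_neg_nat_ne_zero (n : ℕ) : psiGDivGamma (-(n : ℂ)) ≠ 0 := by
  have hrec (s : ℂ) : deriv (fun s => (Complex.Gamma s)⁻¹) s =
      (Complex.Gamma (s + 1))⁻¹ + s * deriv (fun s => (Complex.Gamma s)⁻¹) (s + 1) := by
    have h := (hasDerivAt_id s).mul
      ((Complex.differentiable_one_div_Gamma (s + 1)).hasDerivAt.comp_add_const s 1)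
    have he : (fun s => (Complex.Gamma s)⁻¹) =
        fun s => s * (Complex.Gamma (s + 1))⁻¹ :=
      funext Complex.one_div_Gamma_eq_self_mul_one_div_Gamma_add_one
    conv_lhs => rw [he]
    exact h.deriv.trans (by simp)
  have hderiv (m : ℕ) : deriv (fun s => (Complex.Gamma s)⁻¹) (-(m : ℂ)) ≠ 0 := by
    induction m with
    | zero => rw [hrec]; simp
    | succ m ih =>
      have hm : (-((m + 1 : ℕ) : ℂ)) + 1 = -m := by push_cast; ring
      rw [hrec, hm, Complex.Gamma_neg_nat_eq_zero, inv_zero, zero_add]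
      exact mul_ne_zero (neg_ne_zero.2 (by exact_mod_cast m.succ_ne_zero)) ih
  rw [psiGDivGamma, Complex.Gamma_neg_nat_eq_zero, inv_zero, mul_zero, zero_add, sub_neg_eq_add]
  exact mul_ne_zero (by exact_mod_cast (by lia : 1 + n ≠ 0)) (hderiv n)

lemma one_lt_log_two_pi : 1 < Real.log (2 * Real.pi) := by
  rw [Real.lt_log_iff_exp_lt (by positivity)]
  linarith [Real.exp_one_lt_d9, Real.pi_gt_three]

lemma log_two_pi_lt_two : Real.log (2 * Real.pi) < 2 := by
  rw [Real.log_lt_iff_lt_exp (by positivity), show (2 : ℝ) = 1 + 1 by norm_num, Real.exp_add]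
  nlinarith [Real.exp_one_gt_d9, Real.pi_lt_d2]

lemma psiGDivGamma_natCast_add_one (n : ℕ) :
    psiGDivGamma (((n : ℝ) + 1 : ℝ) : ℂ) =
      (((Real.log (2 * Real.pi) + 1) / 2 - (n + 1) +
        n * (-Real.eulerMascheroniConstant + harmonic n)) / n.factorial : ℝ) := by
  have hn : ∀ m : ℕ, (n : ℂ) + 1 ≠ -(m : ℂ) := fun m h => by
    have : ((n + 1 + m : ℕ) : ℂ) = 0 := by push_cast; linear_combination h
    norm_cast at this
    lia
  have hfac : (n.factorial : ℂ) ≠ 0 := by exact_mod_cast n.factorial_ne_zero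
  push_cast
  rw [psiGDivGamma, deriv_inv_Gamma hn, Complex.deriv_Gamma_nat, Complex.Gamma_nat_eq_factorial]
  push_cast
  field_simp
  ring

lemma psiGDivGamma_two : ∃ r < (0 : ℝ), psiGDivGamma ((2 : ℝ) : ℂ) = r := by
  have h := psiGDivGamma_natCast_add_one 1
  refine ⟨_, ?_, by rw [← h]; norm_num⟩
  have h1 : (harmonic 1 : ℝ) = 1 := by norm_num [harmonic, Finset.sum_range_succ]
  rw [h1]
  refine div_neg_of_neg_of_pos ?_ (by positivity)
  push_cast
  linarith [log_two_pi_lt_two, Real.one_half_lt_eulerMascheroniConstant]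

lemma psiGDivGamma_four : ∃ r > (0 : ℝ), psiGDivGamma ((4 : ℝ) : ℂ) = r := by
  have h := psiGDivGamma_natCast_add_one 3
  refine ⟨_, ?_, by rw [← h]; norm_num⟩
  have h3 : (harmonic 3 : ℝ) = 11 / 6 := by norm_num [harmonic, Finset.sum_range_succ]
  rw [h3]
  refine div_pos ?_ (by positivity)
  push_cast
  linarith [one_lt_log_two_pi, Real.eulerMascheroniConstant_lt_two_thirds]

lemma psiGDivGamma_one : ∃ r > (0 : ℝ), psiGDivGamma ((1 : ℝ) : ℂ) = r := by
  have h := psiGDivGamma_natCast_add_one 0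
  refine ⟨_, ?_, by rw [← h]; norm_num⟩
  simp
  linarith [one_lt_log_two_pi]

lemma psiGDivGamma_zeroLower_ne_zero : ∀ k, psiGDivGamma (zeroLower k : ℂ) ≠ 0
  | 0 => by
    obtain ⟨r, hr, h⟩ := psiGDivGamma_one
    rw [zeroLower, h]
    exact_mod_cast hr.ne'
  | 1 => by
    obtain ⟨r, hr, h⟩ := psiGDivGamma_two
    rw [zeroLower, h]
    exact_mod_cast hr.ne
  | k + 2 => by simpa [zeroLower] using psiGDivGamma_neg_nat_ne_zero (k + 1)

lemma psiGDivGamma_zeroUpper_ne_zero : ∀ k, psiGDivGamma (zeroUpper k : ℂ) ≠ 0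
  | 0 => psiGDivGamma_zeroLower_ne_zero 1
  | 1 => by
    obtain ⟨r, hr, h⟩ := psiGDivGamma_four
    rw [zeroUpper, h]
    exact_mod_cast hr.ne'
  | k + 2 => by simpa [zeroUpper] using psiGDivGamma_neg_nat_ne_zero k

/-- For real arguments the approximants are real. -/
lemma aeval_mul_exp_ofReal (q : ℝ[X]) (x L : ℝ) :
    aeval (x : ℂ) q * Complex.exp (-(x * (L : ℂ))) = ((q.eval x * Real.exp (-(x * L)) : ℝ) : ℂ) := by
  rw [← Complex.coe_algebraMap, aeval_algebraMap_apply, coe_aeval_eq_eval]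
  simp

/-- Product formula for `ψ_G / Γ` over some enumeration of its zeros. -/
lemma exists_psiGDivGamma_eq_tprod : ∃ y : ℕ → ℝ, Function.Injective y ∧
    (∀ k : ℕ, (k : ℝ) - 2 ≤ |y k|) ∧ (∀ k, y k ≠ 0) ∧ (∀ k, psiGDivGamma (y k) = 0) ∧
    ∀ z, psiGDivGamma z = Complex.exp (((2 * Real.eulerMascheroniConstant +
      Real.log (2 * Real.pi) / 2 - 1 / 2 : ℝ) : ℂ) * z) * ∏' k, elemFactor z (y k) := by
  set A : ℝ := (Real.log (2 * Real.pi) + 1) / 2 with hA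
  have hA1 : 1 < A := by linarith [one_lt_log_two_pi]
  have hreal (x : ℝ) : Tendsto (fun n : ℕ => (((approxPoly A (Real.log (n + 1)) n).eval x *
      Real.exp (-(x * Real.log (n + 1))) : ℝ) : ℂ)) atTop (𝓝 (psiGDivGamma x)) :=
    (tendsto_approxPoly_mul_exp tendsto_id (tendsto_const_nhds (x := (x : ℂ)))).congr fun n =>
      aeval_mul_exp_ofReal _ _ _
  have h2 : ∀ᶠ n : ℕ in atTop, (approxPoly A (Real.log (n + 1)) n).eval 2 < 0 := by
    obtain ⟨r, hr, h⟩ := psiGDivGamma_two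
    have ht := hreal 2
    rw [h] at ht
    filter_upwards [(tendsto_ofReal_iff.1 ht).eventually_lt_const hr] with n hn
    exact neg_of_mul_neg_left hn (Real.exp_pos _).le
  have h4 : ∀ᶠ n : ℕ in atTop, 0 < (approxPoly A (Real.log (n + 1)) n).eval 4 := by
    obtain ⟨r, hr, h⟩ := psiGDivGamma_four
    have ht := hreal 4
    rw [h] at ht
    filter_upwards [(tendsto_ofReal_iff.1 ht).eventually_const_lt hr] with n hn
    exact pos_of_mul_pos_left hn (Real.exp_pos _).le
  have hex (n k : ℕ) : ∃ x ∈ Set.Ioo (zeroLower k) (zeroUpper k),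
      (approxPoly A (Real.log (n + 1)) n).eval 2 < 0 →
      0 < (approxPoly A (Real.log (n + 1)) n).eval 4 → k < n + 2 →
      (approxPoly A (Real.log (n + 1)) n).eval x = 0 := by
    by_cases h : (approxPoly A (Real.log (n + 1)) n).eval 2 < 0 ∧
      0 < (approxPoly A (Real.log (n + 1)) n).eval 4 ∧ k < n + 2
    · obtain ⟨x, hx, hx0⟩ := exists_root_approxPoly hA1 h.1 h.2.1 h.2.2
      exact ⟨x, hx, fun _ _ _ => hx0⟩
    · obtain ⟨x, hx⟩ := Set.nonempty_Ioo.2 (zeroLower_lt_zeroUpper k)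
      exact ⟨x, hx, fun a b c => absurd ⟨a, b, c⟩ h⟩
  choose x hxmem hxroot using hex
  have hcpt : IsCompact (Set.univ.pi fun k => Set.Icc (zeroLower k) (zeroUpper k)) :=
    isCompact_univ_pi fun k => isCompact_Icc
  obtain ⟨y, hy, φ, hφ, hlim⟩ := hcpt.tendsto_subseq (x := x) fun n k _ =>
    Set.Ioo_subset_Icc_self (hxmem n k)
  have hyIcc (k : ℕ) : y k ∈ Set.Icc (zeroLower k) (zeroUpper k) := hy k trivial
  have hφt := hφ.tendsto_atTop
  have hlimk (k : ℕ) : Tendsto (fun n => x (φ n) k) atTop (𝓝 (y k)) :=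
    (tendsto_pi_nhds.1 hlim) k
  have hzero (k : ℕ) : psiGDivGamma (y k) = 0 := by
    have ht := tendsto_approxPoly_mul_exp hφt
      ((Complex.continuous_ofReal.tendsto _).comp (hlimk k))
    refine tendsto_nhds_unique ht (tendsto_const_nhds.congr' ?_)
    filter_upwards [hφt.eventually h2, hφt.eventually h4, hφt.eventually_ge_atTop k]
      with n hn2 hn4 hnk
    rw [Function.comp_apply, aeval_mul_exp_ofReal, hxroot (φ n) k hn2 hn4 (by lia)]
    simp
  have hyIoo (k : ℕ) : y k ∈ Set.Ioo (zeroLower k) (zeroUpper k) := by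
    refine ⟨(hyIcc k).1.lt_of_ne fun h => ?_, (hyIcc k).2.lt_of_ne fun h => ?_⟩
    · exact psiGDivGamma_zeroLower_ne_zero k (h ▸ hzero k)
    · exact psiGDivGamma_zeroUpper_ne_zero k (h ▸ hzero k)
  refine ⟨y, fun j k hjk => eq_of_mem_Ioo_zeroLower_zeroUpper (hyIoo j) (hjk ▸ hyIoo k),
    fun k => sub_two_le_abs_of_mem_Icc (hyIcc k),
    fun k => ne_zero_of_mem_Ioo_zeroLower_zeroUpper (hyIoo k), hzero, fun z => ?_⟩
  have hprod := tendsto_prod_elemFactor z (u := fun n => x (φ n)) (N := fun n => φ n + 2)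
    ((tendsto_add_atTop_nat 2).comp hφt) hlimk
    (fun k => ne_zero_of_mem_Ioo_zeroLower_zeroUpper (hyIoo k))
    fun n k => sub_two_le_abs_of_mem_Icc (Set.Ioo_subset_Icc_self (hxmem _ k))
  have hc : Tendsto (fun n => A - 1 + 2 * Real.eulerMascheroniSeq (φ n)) atTop
      (𝓝 (2 * Real.eulerMascheroniConstant + Real.log (2 * Real.pi) / 2 - 1 / 2)) := by
    rw [show 2 * Real.eulerMascheroniConstant + Real.log (2 * Real.pi) / 2 - 1 / 2 =
      A - 1 + 2 * Real.eulerMascheroniConstant by rw [hA]; ring]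
    exact ((Real.tendsto_eulerMascheroniSeq.comp hφt).const_mul 2).const_add (A - 1)
  have hexp := (Complex.continuous_exp.tendsto _).comp
    (((Complex.continuous_ofReal.tendsto _).comp hc).mul_const z)
  refine tendsto_nhds_unique (tendsto_approxPoly_mul_exp hφt tendsto_const_nhds)
    ((hexp.mul hprod).congr' ?_)
  filter_upwards [hφt.eventually h2, hφt.eventually h4] with n hn2 hn4
  rw [aeval_approxPoly_eq_prod (fun k _ => hxmem (φ n) k)
    (fun k hk => hxroot (φ n) k hn2 hn4 hk), mul_right_comm, ← Complex.exp_add]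
  simp only [Function.comp_apply, Real.eulerMascheroniSeq]
  congr 2
  push_cast
  ring

open Real in
/-- Weierstrass product for `ψ_G(z)/Γ(z)`: for `z` not a nonpositive integer,
`ψ_G(z)/Γ(z) = e^{(2γ + (1/2)log 2π - 1/2)z} ∏_{k=0}^∞ (1 - z/β_k) e^{z/β_k}`, where `β`
is the strictly decreasing enumeration of the zeros of `ψ_G`. -/
theorem psiG_div_Gamma_weierstrass_product
    (β : ℕ → ℝ) (hanti : StrictAnti β)
    (hzero : ∀ k : ℕ, psiG (β k : ℂ) = 0)
    (henum : ∀ x : ℝ, (∀ n : ℕ, x ≠ -(n : ℝ)) → psiG (x : ℂ) = 0 → ∃ k : ℕ, β k = x)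
    (z : ℂ) (hz : ∀ n : ℕ, z ≠ -(n : ℂ)) :
    Multipliable (fun k : ℕ => (1 - z / (β k : ℂ)) * Complex.exp (z / (β k : ℂ))) ∧
    psiG z / Complex.Gamma z =
      Complex.exp ((2 * (eulerMascheroniConstant : ℂ) +
          (Real.log (2 * π) : ℂ) / 2 - 1 / 2) * z) *
        ∏' k : ℕ, (1 - z / (β k : ℂ)) * Complex.exp (z / (β k : ℂ)) := by
  obtain ⟨y, hinj, hbd, hy0, hyz, hprod⟩ := exists_psiGDivGamma_eq_tprod
  have hβnat (k n : ℕ) : (β k : ℂ) ≠ -(n : ℂ) := by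
    intro h
    have h0 := hzero k
    rw [h, psiG, logDeriv_apply, Complex.Gamma_neg_nat_eq_zero, div_zero, mul_zero, add_zero] at h0
    have h1 : (Real.log (2 * π) + 1) / 2 + n = 0 := by
      have h2 : (((Real.log (2 * π) + 1) / 2 + n : ℝ) : ℂ) = 0 := by
        push_cast
        linear_combination h0
      exact_mod_cast h2
    linarith [one_lt_log_two_pi, n.cast_nonneg (α := ℝ)]
  have hrange : Set.range y = Set.range β := by
    ext t
    constructor
    · rintro ⟨k, rfl⟩
      have hnat (n : ℕ) : y k ≠ -(n : ℝ) := fun h =>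
        psiGDivGamma_neg_nat_ne_zero n (by simpa [h] using hyz k)
      have hnat' (n : ℕ) : (y k : ℂ) ≠ -(n : ℂ) := by exact_mod_cast hnat n
      refine henum (y k) hnat ?_
      have h := psiG_div_Gamma_eq hnat'
      rw [hyz k] at h
      exact (div_eq_zero_iff.1 h).resolve_right (Complex.Gamma_ne_zero hnat')
    · rintro ⟨k, rfl⟩
      have h := psiG_div_Gamma_eq (hβnat k)
      rw [hzero k, zero_div, hprod] at h
      by_contra hk
      refine mul_ne_zero (Complex.exp_ne_zero _) (tprod_elemFactor_ne_zero hbd fun j hj => hk ⟨j, ?_⟩)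
        h.symm
      have h1 := (mul_eq_zero.1 hj).resolve_right (Complex.exp_ne_zero _)
      have hyj : (y j : ℂ) ≠ 0 := by exact_mod_cast hy0 j
      have h2 := (div_eq_one_iff_eq hyj).1 (sub_eq_zero.1 h1).symm
      exact_mod_cast h2.symm
  let e : ℕ ≃ ℕ := (Equiv.ofInjective β hanti.injective).trans
    ((Equiv.setCongr hrange.symm).trans (Equiv.ofInjective y hinj).symm)
  have he (k : ℕ) : y (e k) = β k := by
    simp [e, Equiv.apply_ofInjective_symm]
  have hfun : (fun k : ℕ => (1 - z / (β k : ℂ)) * Complex.exp (z / (β k : ℂ))) =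
      (fun k => elemFactor z (y k)) ∘ e := by
    ext k
    simp [elemFactor, he]
  rw [hfun]
  refine ⟨e.multipliable_iff.2 (multipliable_elemFactor z hbd), ?_⟩
  rw [psiG_div_Gamma_eq hz, hprod, ← e.tprod_eq]
  push_cast
  rfl
end

section
/- The series ∑_{k=0}^∞ 1/β_k² converges and ∑_{k=0}^∞ 1/β_k² = 9/4 + π²/2 + γ·(1 + γ + log(2π)) − (1/2)log(2π) + (1/4)log²(2π). -/
open Filter Topology

/-- On the real line, the digamma function is monotone to the right of the origin. -/
lemma monotoneOn_logDeriv_Gamma : MonotoneOn (logDeriv Real.Gamma) (Set.Ioi 0) := by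
  have hd : ∀ x ∈ Set.Ioi (0 : ℝ), DifferentiableAt ℝ Real.Gamma x := fun x hx =>
    Real.differentiableAt_Gamma fun m => by
      have : (0 : ℝ) < x := hx
      have := m.cast_nonneg (α := ℝ)
      linarith
  refine (Real.convexOn_log_Gamma.monotoneOn_deriv fun x hx =>
    (hd x hx).log (Real.Gamma_pos_of_pos hx).ne').congr fun x hx => ?_
  rw [logDeriv_apply]
  exact deriv.log (hd x hx) (Real.Gamma_pos_of_pos hx).ne'

lemma logDeriv_Gamma_ofReal {x : ℝ} (hx : 0 < x) :
    logDeriv Complex.Gamma (x : ℂ) = (logDeriv Real.Gamma x : ℝ) := by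
  have hne (m : ℕ) : (x : ℂ) ≠ -m := by
    intro h
    have h' : x = -(m : ℝ) := by exact_mod_cast h
    have := m.cast_nonneg (α := ℝ)
    linarith
  have hc := (Complex.differentiableAt_Gamma _ hne).hasDerivAt
  have h1 := hc.comp_ofReal
  have h2 : HasDerivAt Real.Gamma (deriv Real.Gamma x) x := by
    refine (Real.differentiableAt_Gamma fun m h => hne m ?_).hasDerivAt
    exact_mod_cast h
  have h3 := h2.ofReal_comp
  simp only [← Complex.Gamma_ofReal] at h3
  rw [logDeriv_apply, logDeriv_apply, h1.unique h3, Complex.Gamma_ofReal]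
  push_cast
  rfl

lemma logDeriv_Gamma_natCast_add_one (n : ℕ) :
    logDeriv Real.Gamma (n + 1) = harmonic n - Real.eulerMascheroniConstant := by
  rw [logDeriv_apply, Real.deriv_Gamma_nat, Real.Gamma_nat_eq_factorial]
  field_simp
  ring

lemma logDeriv_Gamma_add_nat {s : ℂ} (hs : ∀ m : ℕ, s ≠ -m) (N : ℕ) :
    logDeriv Complex.Gamma (s + N) =
      logDeriv Complex.Gamma s + ∑ n ∈ Finset.range N, (s + n)⁻¹ := by
  induction N with
  | zero => simp
  | succ N ih =>
    have := Complex.digamma_apply_add_one (s + N) fun m h => hs (N + m) (by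
      push_cast; linear_combination h)
    rw [Complex.digamma_def] at this
    rw [Finset.sum_range_succ, ← add_assoc, ← ih, ← this]
    push_cast
    ring_nf

lemma tendsto_log_add_nat_sub_log (a : ℝ) :
    Tendsto (fun N : ℕ => Real.log (N + a) - Real.log N) atTop (𝓝 0) := by
  have h : Tendsto (fun N : ℕ => Real.log (1 + a / N)) atTop (𝓝 0) := by
    have := (tendsto_const_div_atTop_nhds_zero_nat a).const_add 1
    rw [add_zero] at this
    simpa [Function.comp_def] using (Real.continuousAt_log one_ne_zero).tendsto.comp this
  refine h.congr' ?_
  filter_upwards [eventually_gt_atTop 0, eventually_gt_atTop ⌈|a|⌉₊] with N h0 hN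
  have h0' : (0 : ℝ) < N := by exact_mod_cast h0
  have : |a| < N := Nat.lt_of_ceil_lt hN
  have := neg_abs_le a
  rw [← Real.log_div (by linarith) h0'.ne']
  congr 1
  field_simp

lemma tendsto_logDeriv_Gamma_natCast_add_int_sub_log (a : ℤ) :
    Tendsto (fun N : ℕ => logDeriv Real.Gamma (N + a) - Real.log N) atTop (𝓝 0) := by
  have h1 : Tendsto (fun n : ℕ => logDeriv Real.Gamma (n + 1) - Real.log n) atTop (𝓝 0) := by
    have := Real.tendsto_harmonic_sub_log.sub_const Real.eulerMascheroniConstant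
    rw [sub_self] at this
    refine this.congr fun n => ?_
    rw [logDeriv_Gamma_natCast_add_one]
    ring
  have h2 : Tendsto (fun N : ℕ => ((N : ℤ) + (a - 1)).toNat) atTop atTop := by
    rw [tendsto_atTop_atTop]
    exact fun b => ⟨b + (a - 1).natAbs, fun N hN => by lia⟩
  have h3 := (h1.comp h2).add (tendsto_log_add_nat_sub_log ((a : ℝ) - 1))
  rw [add_zero] at h3
  refine h3.congr' ?_
  filter_upwards [eventually_ge_atTop (a - 1).natAbs] with N hN
  have : ((((N : ℤ) + (a - 1)).toNat : ℕ) : ℝ) = N + (a - 1) := by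
    have h : ((((N : ℤ) + (a - 1)).toNat : ℕ) : ℤ) = N + (a - 1) := Int.toNat_of_nonneg (by lia)
    exact_mod_cast congrArg (Int.cast : ℤ → ℝ) h
  simp only [Function.comp_apply, this]
  ring_nf

/-- Euler's limit for the digamma function on the real line. -/
lemma tendsto_log_sub_sum_logDeriv_Gamma {x : ℝ} (hx : ∀ m : ℕ, x ≠ -m) :
    Tendsto (fun N : ℕ => ((Real.log N - ∑ n ∈ Finset.range N, (x + n)⁻¹ : ℝ) : ℂ)) atTop
      (𝓝 (logDeriv Complex.Gamma x)) := by
  have hx' (m : ℕ) : (x : ℂ) ≠ -m := fun h => hx m (by exact_mod_cast h)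
  obtain ⟨m, hm⟩ := exists_nat_gt |x|
  have hm' := abs_lt.mp hm
  have hlim : Tendsto (fun N : ℕ => logDeriv Real.Gamma (x + N) - Real.log N) atTop (𝓝 0) := by
    refine tendsto_of_tendsto_of_tendsto_of_le_of_le'
      (tendsto_logDeriv_Gamma_natCast_add_int_sub_log (-m))
      (tendsto_logDeriv_Gamma_natCast_add_int_sub_log m) ?_ ?_
    all_goals
      filter_upwards [eventually_gt_atTop m] with N hN
      have hN' : (m : ℝ) < N := by exact_mod_cast hN
      have := m.cast_nonneg (α := ℝ)
      push_cast
      gcongr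
      exact monotoneOn_logDeriv_Gamma (Set.mem_Ioi.2 (by linarith)) (Set.mem_Ioi.2 (by linarith))
        (by linarith)
  have hlim' := (Complex.continuous_ofReal.tendsto 0).comp hlim
  have := (tendsto_const_nhds (x := logDeriv Complex.Gamma x)).sub hlim'
  rw [Complex.ofReal_zero, sub_zero] at this
  refine this.congr' ?_
  filter_upwards [eventually_gt_atTop m] with N hN
  have hN' : (m : ℝ) < N := by exact_mod_cast hN
  have h := logDeriv_Gamma_add_nat hx' N
  have h' := logDeriv_Gamma_ofReal (x := x + N) (by linarith)
  push_cast at h'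
  simp only [Function.comp_apply]
  push_cast
  rw [← h', h]
  ring

/-- The partial fraction series `∑ wₙ / ((n + 1) (x + n))` with weights `w`. -/
noncomputable def poleSum (w : ℕ → ℝ) (x : ℝ) : ℝ := ∑' n : ℕ, w n / ((n + 1) * (x + n))

/-- A weighted version of `ψ_G` on the real line, in which the pole at `-n` comes with weight `wₙ`;
`ψ_G` itself has all weights equal to `1`. -/
noncomputable def weightedPsiG (w : ℕ → ℝ) (x : ℝ) : ℝ :=
  (Real.log (2 * Real.pi) - 1) / 2 - (1 + Real.eulerMascheroniConstant) * (x - 1) +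
    (x - 1) ^ 2 * poleSum w x

lemma summable_one_div_add_nat_sq (x : ℝ) : Summable fun n : ℕ => 1 / (x + n) ^ 2 := by
  have := (Real.summable_one_div_nat_add_rpow x 2).2 one_lt_two
  refine this.congr fun n => ?_
  rw [Real.rpow_two, sq_abs, add_comm]

lemma abs_div_mul_le {w a b : ℝ} (h0 : 0 ≤ w) (h1 : w ≤ 1) :
    |w / (a * b)| ≤ 1 / a ^ 2 + 1 / b ^ 2 := by
  have e : |w / (a * b)| = w * (|1 / a| * |1 / b|) := by
    rw [← abs_mul, div_mul_div_comm, one_mul, ← abs_of_nonneg h0, ← abs_mul, abs_of_nonneg h0,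
      mul_one_div]
  have ha : 1 / a ^ 2 = |1 / a| ^ 2 := by rw [sq_abs, one_div_pow]
  have hb : 1 / b ^ 2 = |1 / b| ^ 2 := by rw [sq_abs, one_div_pow]
  rw [e, ha, hb]
  have := mul_nonneg (abs_nonneg (1 / a)) (abs_nonneg (1 / b))
  nlinarith [sq_nonneg (|1 / a| - |1 / b|), mul_le_mul_of_nonneg_right h1 this]

lemma summable_weights_div_mul {w : ℕ → ℝ} (h0 : ∀ n, 0 ≤ w n) (h1 : ∀ n, w n ≤ 1) (a b : ℝ) :
    Summable fun n : ℕ => w n / ((a + n) * (b + n)) :=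
  ((summable_one_div_add_nat_sq a).add (summable_one_div_add_nat_sq b)).of_norm_bounded
    fun n => abs_div_mul_le (h0 n) (h1 n)

lemma summable_poleSum {w : ℕ → ℝ} (h0 : ∀ n, 0 ≤ w n) (h1 : ∀ n, w n ≤ 1) (x : ℝ) :
    Summable fun n : ℕ => w n / ((n + 1) * (x + n)) := by
  simpa only [add_comm (1 : ℝ)] using summable_weights_div_mul h0 h1 1 x

/-- On the real line `ψ_G` is given by its partial fraction expansion. -/
lemma psiG_ofReal {x : ℝ} (hx : ∀ m : ℕ, x ≠ -m) : psiG x = (weightedPsiG 1 x : ℝ) := by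
  have hne (n : ℕ) : x + n ≠ 0 := fun h => hx n (by linarith)
  have hsum : Summable fun n : ℕ => (1 : ℕ → ℝ) n / ((n + 1) * (x + n)) :=
    summable_poleSum (fun _ => zero_le_one) (fun _ => le_rfl) x
  have hlim := (hsum.hasSum.tendsto_sum_nat.const_mul (x - 1)).sub_const
    Real.eulerMascheroniConstant
  have hlim' := hlim.sub (Real.tendsto_harmonic_sub_log.sub_const Real.eulerMascheroniConstant)
  have h := (Complex.continuous_ofReal.tendsto _).comp hlim'
  have hψ := tendsto_nhds_unique (tendsto_log_sub_sum_logDeriv_Gamma hx) (h.congr fun N => ?_)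
  · rw [psiG, hψ, weightedPsiG, poleSum]
    push_cast
    ring
  · simp only [Function.comp_apply]
    congr 1
    have e : (x - 1) * ∑ n ∈ Finset.range N, (1 : ℕ → ℝ) n / ((n + 1) * (x + n)) =
        harmonic N - ∑ n ∈ Finset.range N, (x + n)⁻¹ := by
      rw [harmonic, Finset.mul_sum, Rat.cast_sum, ← Finset.sum_sub_distrib]
      refine Finset.sum_congr rfl fun n _ => ?_
      have := hne n
      have : (n : ℝ) + 1 ≠ 0 := by positivity
      push_cast
      simp only [Pi.one_apply]
      field_simp
      ring
    rw [e]
    ring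

lemma psiG_neg_natCast_ne_zero (n : ℕ) : psiG ((-(n : ℝ) : ℝ) : ℂ) ≠ 0 := by
  have hlog : 0 < Real.log (2 * Real.pi) := Real.log_pos (by linarith [Real.pi_gt_three])
  have h : psiG ((-(n : ℝ) : ℝ) : ℂ) = (((Real.log (2 * Real.pi) + 1) / 2 + n : ℝ) : ℂ) := by
    rw [psiG, logDeriv_apply]
    push_cast
    rw [Complex.Gamma_neg_nat_eq_zero]
    simp
  rw [h, Complex.ofReal_ne_zero]
  positivity

lemma continuousOn_poleSum {w : ℕ → ℝ} (h0 : ∀ n, 0 ≤ w n) (h1 : ∀ n, w n ≤ 1) {p q : ℝ}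
    (hpq : ∀ n : ℕ, w n = 0 ∨ 0 < (p + n) * (q + n)) : ContinuousOn (poleSum w) (Set.Icc p q) := by
  have key (n : ℕ) (x : ℝ) (hx : x ∈ Set.Icc p q) (hn : 0 < (p + n) * (q + n)) :
      x + n ≠ 0 ∧ 1 / (x + n) ^ 2 ≤ 1 / (p + n) ^ 2 + 1 / (q + n) ^ 2 := by
    obtain ⟨hp, hq⟩ := hx
    rcases pos_and_pos_or_neg_and_neg_of_mul_pos hn with ⟨h, h'⟩ | ⟨h, h'⟩
    · refine ⟨by linarith, le_add_of_le_of_nonneg ?_ (by positivity)⟩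
      exact one_div_le_one_div_of_le (by positivity) (by nlinarith)
    · refine ⟨by linarith, le_add_of_nonneg_of_le (by positivity) ?_⟩
      exact one_div_le_one_div_of_le (by nlinarith) (by nlinarith)
  refine continuousOn_tsum (u := fun n : ℕ => 1 / (1 + (n : ℝ)) ^ 2 +
    (1 / (p + n) ^ 2 + 1 / (q + n) ^ 2)) (fun n => ?_)
    ((summable_one_div_add_nat_sq 1).add
      ((summable_one_div_add_nat_sq p).add (summable_one_div_add_nat_sq q))) fun n x hx => ?_
  · rcases hpq n with h | h
    · simp only [h, zero_div]
      exact continuousOn_const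
    · refine continuousOn_const.div (by fun_prop) fun x hx => ?_
      exact mul_ne_zero (by positivity) (key n x hx h).1
  · rw [Real.norm_eq_abs]
    rcases hpq n with h | h
    · rw [h, zero_div, abs_zero]
      positivity
    · refine (abs_div_mul_le (h0 n) (h1 n)).trans ?_
      rw [add_comm (n : ℝ)]
      gcongr
      exact (key n x hx h).2

lemma continuousAt_poleSum {w : ℕ → ℝ} (h0 : ∀ n, 0 ≤ w n) (h1 : ∀ n, w n ≤ 1) {p q x : ℝ}
    (hpq : ∀ n : ℕ, w n = 0 ∨ 0 < (p + n) * (q + n)) (hx : x ∈ Set.Ioo p q) :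
    ContinuousAt (poleSum w) x :=
  (continuousOn_poleSum h0 h1 hpq).continuousAt (Icc_mem_nhds hx.1 hx.2)

lemma poleSum_eq_update_add {w : ℕ → ℝ} (h0 : ∀ n, 0 ≤ w n) (h1 : ∀ n, w n ≤ 1) (k : ℕ) (x : ℝ) :
    poleSum w x = poleSum (Function.update w k 0) x + w k / ((k + 1) * (x + k)) := by
  rw [poleSum, (summable_poleSum h0 h1 x).tsum_eq_add_tsum_ite k, add_comm, poleSum]
  congr 1
  refine tsum_congr fun n => ?_
  rw [Function.update_apply]
  split_ifs <;> simp

/-- Near the pole `-k` the sign of `weightedPsiG w` is that of `x + k`. -/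
lemma eventually_mul_weightedPsiG_pos {w : ℕ → ℝ} (h0 : ∀ n, 0 ≤ w n) (h1 : ∀ n, w n ≤ 1) {k : ℕ}
    (hk : w k = 1) : ∀ᶠ x in 𝓝[≠] (-(k : ℝ)), 0 < (x + k) * weightedPsiG w x := by
  set v := Function.update w k 0 with hv
  have hc : ContinuousAt (poleSum v) (-(k : ℝ)) := by
    refine continuousAt_poleSum (p := -k - 1 / 2) (q := -k + 1 / 2) ?_ ?_ ?_ ⟨by linarith, by linarith⟩
    · intro n
      rw [hv, Function.update_apply]
      split_ifs
      exacts [le_rfl, h0 n]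
    · intro n
      rw [hv, Function.update_apply]
      split_ifs
      exacts [zero_le_one, h1 n]
    · intro n
      rcases lt_trichotomy n k with h | rfl | h
      · have : (n : ℝ) + 1 ≤ k := by exact_mod_cast h
        exact Or.inr (mul_pos_of_neg_of_neg (by linarith) (by linarith))
      · exact Or.inl (Function.update_self ..)
      · have : (k : ℝ) + 1 ≤ n := by exact_mod_cast h
        exact Or.inr (mul_pos (by linarith) (by linarith))
  have hE : ContinuousAt (fun x : ℝ => (x + k) * ((Real.log (2 * Real.pi) - 1) / 2 -
      (1 + Real.eulerMascheroniConstant) * (x - 1) + (x - 1) ^ 2 * poleSum v x) +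
      (x - 1) ^ 2 / (k + 1)) (-(k : ℝ)) := by fun_prop
  have hpos := hE.eventually (lt_mem_nhds (a := 0) (by
    beta_reduce
    rw [neg_add_cancel, zero_mul, zero_add]
    have : -(k : ℝ) - 1 ≠ 0 := by linarith [k.cast_nonneg (α := ℝ)]
    positivity))
  filter_upwards [hpos.filter_mono nhdsWithin_le_nhds, self_mem_nhdsWithin] with x hx hne
  have hne' : x + k ≠ 0 := fun h => hne (by simp only [Set.mem_singleton_iff]; linarith)
  convert! hx using 1
  rw [weightedPsiG, poleSum_eq_update_add h0 h1 k, hk]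
  field_simp
  ring

/-- If `b` and `z` are two distinct zeros, then the quotient by `x - b` vanishes at `z`. -/
lemma tsum_eq_of_zeros {w : ℕ → ℝ} (h0 : ∀ n, 0 ≤ w n) (h1 : ∀ n, w n ≤ 1) {b z : ℝ}
    (hb : ∀ n : ℕ, b + n ≠ 0) (hz : ∀ n : ℕ, z + n ≠ 0) (hne : z ≠ b)
    (hFb : weightedPsiG w b = 0) (hFz : weightedPsiG w z = 0) :
    (Real.log (2 * Real.pi) - 1) / 2 =
      (b - 1) * ((z - 1) * ∑' n : ℕ, w n / ((z + n) * (b + n))) := by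
  have e : (z - 1) * poleSum w z - (b - 1) * poleSum w b =
      (z - b) * ∑' n : ℕ, w n / ((z + n) * (b + n)) := by
    rw [poleSum, poleSum, ← tsum_mul_left, ← tsum_mul_left, ← tsum_mul_left,
      ← ((summable_poleSum h0 h1 z).mul_left _).tsum_sub ((summable_poleSum h0 h1 b).mul_left _)]
    refine tsum_congr fun n => ?_
    have := hb n
    have := hz n
    have : (n : ℝ) + 1 ≠ 0 := by positivity
    field_simp
    ring
  have h : (z - b) * ((Real.log (2 * Real.pi) - 1) / 2) =
      (z - b) * ((b - 1) * ((z - 1) * ∑' n : ℕ, w n / ((z + n) * (b + n)))) := by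
    rw [weightedPsiG] at hFb hFz
    linear_combination (z - 1) * hFb - (b - 1) * hFz + (z - 1) * (b - 1) * e
  exact mul_left_cancel₀ (sub_ne_zero.2 hne) h

lemma log_two_pi_mem : 1 < Real.log (2 * Real.pi) ∧ Real.log (2 * Real.pi) < 2 := by
  have := Real.pi_gt_d2
  have := Real.pi_lt_d2
  constructor
  · rw [Real.lt_log_iff_exp_lt (by positivity)]
    linarith [Real.exp_one_lt_d9]
  · rw [Real.log_lt_iff_lt_exp (by positivity), show (2 : ℝ) = 1 + 1 by norm_num, Real.exp_add]
    nlinarith [Real.exp_one_gt_d9]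

/-- Besides a positive zero `b`, there is at most one zero between two consecutive poles. -/
lemma weightedPsiG_zero_unique {w : ℕ → ℝ} (h0 : ∀ n, 0 ≤ w n) (h1 : ∀ n, w n ≤ 1) (hw : w 0 = 1)
    {b y z : ℝ} (hb : 0 < b) (hyz : ∀ n : ℕ, 0 < (y + n) * (z + n)) (hyb : y ≠ b) (hzb : z ≠ b)
    (hFb : weightedPsiG w b = 0) (hFy : weightedPsiG w y = 0) (hFz : weightedPsiG w z = 0) :
    y = z := by
  by_contra hne
  have hbn (n : ℕ) : 0 < b + n := by positivity
  have hy (n : ℕ) : y + n ≠ 0 := left_ne_zero_of_mul (hyz n).ne'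
  have hz (n : ℕ) : z + n ≠ 0 := right_ne_zero_of_mul (hyz n).ne'
  have ey := tsum_eq_of_zeros h0 h1 (fun n => (hbn n).ne') hy hyb hFb hFy
  have ez := tsum_eq_of_zeros h0 h1 (fun n => (hbn n).ne') hz hzb hFb hFz
  have hb1 : b - 1 ≠ 0 := by
    intro h
    rw [h, zero_mul] at ey
    linarith [log_two_pi_mem.1]
  have e := mul_left_cancel₀ hb1 (ey.symm.trans ez)
  have hsy := (summable_weights_div_mul h0 h1 y b).mul_left (y - 1)
  have hsz := (summable_weights_div_mul h0 h1 z b).mul_left (z - 1)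
  rw [← tsum_mul_left, ← tsum_mul_left, ← sub_eq_zero, ← hsy.tsum_sub hsz] at e
  have hs := (hsy.sub hsz).mul_left (1 / (y - z))
  have hterm (n : ℕ) : 1 / (y - z) * ((y - 1) * (w n / ((y + n) * (b + n))) -
      (z - 1) * (w n / ((z + n) * (b + n)))) =
      w n * (n + 1) / ((b + n) * ((y + n) * (z + n))) := by
    have := hy n
    have := hz n
    have := (hbn n).ne'
    have := sub_ne_zero.2 hne
    field_simp
    ring
  simp_rw [hterm] at hs
  have hpos : 0 < ∑' n : ℕ, w n * (n + 1) / ((b + n) * ((y + n) * (z + n))) := by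
    refine hs.tsum_pos (fun n => ?_) 0 ?_
    · have := hyz n
      have := hbn n
      have := h0 n
      positivity
    · have := hyz 0
      have := hbn 0
      rw [hw]
      positivity
  simp_rw [← hterm, tsum_mul_left, e] at hpos
  simp at hpos

/-- `f` is continuous on `(a, b)`, positive near `a` and negative near `b`. -/
structure CrossesDown (f : ℝ → ℝ) (a b : ℝ) : Prop where
  lt : a < b
  continuousOn : ContinuousOn f (Set.Ioo a b)
  pos : ∀ᶠ x in 𝓝[>] a, 0 < f x
  neg : ∀ᶠ x in 𝓝[<] b, f x < 0

lemma ContinuousOn.exists_zero_of_pos_of_neg {f : ℝ → ℝ} {p q : ℝ} (hpq : p < q)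
    (hf : ContinuousOn f (Set.Icc p q)) (hp : 0 < f p) (hq : f q < 0) :
    ∃ z ∈ Set.Ioo p q, f z = 0 := by
  obtain ⟨z, hz, h⟩ := intermediate_value_Ioo' hpq.le hf ⟨hq, hp⟩
  exact ⟨z, hz, h⟩

lemma CrossesDown.exists_zero_lt {f : ℝ → ℝ} {a b x : ℝ} (h : CrossesDown f a b)
    (hx : x ∈ Set.Ioo a b) (hfx : f x < 0) : ∃ z ∈ Set.Ioo a x, f z = 0 := by
  obtain ⟨p, hp, hpx⟩ := (h.pos.and (Ioo_mem_nhdsGT hx.1)).exists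
  obtain ⟨z, hz, hfz⟩ := (h.continuousOn.mono
    (Set.Icc_subset_Ioo hpx.1 hx.2)).exists_zero_of_pos_of_neg hpx.2 hp hfx
  exact ⟨z, ⟨hpx.1.trans hz.1, hz.2⟩, hfz⟩

lemma CrossesDown.exists_zero_gt {f : ℝ → ℝ} {a b x : ℝ} (h : CrossesDown f a b)
    (hx : x ∈ Set.Ioo a b) (hfx : 0 < f x) : ∃ z ∈ Set.Ioo x b, f z = 0 := by
  obtain ⟨q, hq, hxq⟩ := (h.neg.and (Ioo_mem_nhdsLT hx.2)).exists
  obtain ⟨z, hz, hfz⟩ := (h.continuousOn.mono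
    (Set.Icc_subset_Ioo hx.1 hxq.2)).exists_zero_of_pos_of_neg hxq.1 hfx hq
  exact ⟨z, ⟨hz.1, hz.2.trans hxq.2⟩, hfz⟩

lemma CrossesDown.exists_zero {f : ℝ → ℝ} {a b : ℝ} (h : CrossesDown f a b) :
    ∃ z ∈ Set.Ioo a b, f z = 0 := by
  obtain ⟨q, hq, haq⟩ := (h.neg.and (Ioo_mem_nhdsLT h.lt)).exists
  obtain ⟨z, hz, hfz⟩ := h.exists_zero_lt haq hq
  exact ⟨z, ⟨hz.1, hz.2.trans haq.2⟩, hfz⟩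

/-- Zeros of pointwise approximations converge to the unique zero of the limit. -/
lemma CrossesDown.tendsto_zero {f : ℝ → ℝ} {a b ζ : ℝ} (h : CrossesDown f a b)
    (hζ : ζ ∈ Set.Ioo a b) (huniq : ∀ y ∈ Set.Ioo a b, f y = 0 → y = ζ)
    {g : ℕ → ℝ → ℝ} {z : ℕ → ℝ} (hg : ∀ N, ContinuousOn (g N) (Set.Ioo a b))
    (hz : ∀ᶠ N in atTop, ∀ y ∈ Set.Ioo a b, g N y = 0 → y = z N)
    (hlim : ∀ x ∈ Set.Ioo a b, Tendsto (fun N => g N x) atTop (𝓝 (f x))) :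
    Tendsto z atTop (𝓝 ζ) := by
  have hpos (x : ℝ) (hx : x ∈ Set.Ioo a ζ) : 0 < f x := by
    have hx' : x ∈ Set.Ioo a b := ⟨hx.1, hx.2.trans hζ.2⟩
    by_contra! hle
    rcases hle.lt_or_eq with hlt | heq
    · obtain ⟨y, hy, hfy⟩ := h.exists_zero_lt hx' hlt
      have := huniq y ⟨hy.1, hy.2.trans hx'.2⟩ hfy
      linarith [hy.2, hx.2]
    · exact hx.2.ne (huniq x hx' heq)
  have hneg (x : ℝ) (hx : x ∈ Set.Ioo ζ b) : f x < 0 := by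
    have hx' : x ∈ Set.Ioo a b := ⟨hζ.1.trans hx.1, hx.2⟩
    by_contra! hle
    rcases hle.lt_or_eq with hlt | heq
    · obtain ⟨y, hy, hfy⟩ := h.exists_zero_gt hx' hlt
      have := huniq y ⟨hx'.1.trans hy.1, hy.2⟩ hfy
      linarith [hy.1, hx.1]
    · exact hx.1.ne' (huniq x hx' heq.symm)
  rw [tendsto_order]
  have key (p q : ℝ) (hp : p ∈ Set.Ioo a ζ) (hq : q ∈ Set.Ioo ζ b) :
      ∀ᶠ N in atTop, z N ∈ Set.Ioo p q := by
    have hp' : p ∈ Set.Ioo a b := ⟨hp.1, hp.2.trans hζ.2⟩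
    have hq' : q ∈ Set.Ioo a b := ⟨hζ.1.trans hq.1, hq.2⟩
    filter_upwards [hz, (hlim p hp').eventually (lt_mem_nhds (hpos p hp)),
      (hlim q hq').eventually (gt_mem_nhds (hneg q hq))] with N hzN hpN hqN
    obtain ⟨y, hy, hgy⟩ := ((hg N).mono (Set.Icc_subset_Ioo hp'.1 hq'.2)).exists_zero_of_pos_of_neg
      (hp.2.trans hq.1) hpN hqN
    rwa [← hzN y ⟨hp'.1.trans hy.1, hy.2.trans hq'.2⟩ hgy]
  obtain ⟨p₀, hp₀⟩ := exists_between hζ.1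
  obtain ⟨q₀, hq₀⟩ := exists_between hζ.2
  constructor
  · intro p hp
    obtain ⟨p', hp'⟩ := exists_between (max_lt hp hζ.1)
    filter_upwards [key p' q₀ ⟨(le_max_right _ _).trans_lt hp'.1, hp'.2⟩ hq₀] with N hN
    exact ((le_max_left _ _).trans_lt hp'.1).trans hN.1
  · intro q hq
    obtain ⟨q', hq'⟩ := exists_between (lt_min hq hζ.2)
    filter_upwards [key p₀ q' hp₀ ⟨hq'.1, hq'.2.trans_le (min_le_right _ _)⟩] with N hN
    exact hN.2.trans (hq'.2.trans_le (min_le_left _ _))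

/-- Left end points of the intervals isolating the zeros of `ψ_G`. -/
def zeroLo : ℕ → ℝ
  | 0 => 2
  | 1 => 1
  | k + 2 => -(k + 1)

/-- Right end points of the intervals isolating the zeros of `ψ_G`, where `M` is an upper bound for
the largest zero. -/
def zeroHi (M : ℝ) : ℕ → ℝ
  | 0 => M
  | 1 => 2
  | k + 2 => -k

/-- The sign of `ψ_G` at the left ends of the intervals isolating its zeros. -/
def zeroSign : ℕ → ℝ
  | 0 => -1
  | _ + 1 => 1

lemma zeroSign_ne_zero (j : ℕ) : zeroSign j ≠ 0 := by
  cases j <;> simp [zeroSign]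

lemma mul_pos_of_mem_zeroInterval {M : ℝ} {j : ℕ} {y z : ℝ}
    (hy : y ∈ Set.Ioo (zeroLo j) (zeroHi M j)) (hz : z ∈ Set.Ioo (zeroLo j) (zeroHi M j)) (n : ℕ) :
    0 < (y + n) * (z + n) := by
  have hn := n.cast_nonneg (α := ℝ)
  match j, hy, hz with
  | 0, hy, hz =>
    simp only [zeroLo, zeroHi, Set.mem_Ioo] at hy hz
    exact mul_pos (by linarith) (by linarith)
  | 1, hy, hz =>
    simp only [zeroLo, zeroHi, Set.mem_Ioo] at hy hz
    exact mul_pos (by linarith) (by linarith)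
  | k + 2, hy, hz =>
    simp only [zeroLo, zeroHi, Set.mem_Ioo] at hy hz
    rcases le_or_gt n k with h | h
    · have : (n : ℝ) ≤ k := by exact_mod_cast h
      exact mul_pos_of_neg_of_neg (by linarith) (by linarith)
    · have : (k : ℝ) + 1 ≤ n := by exact_mod_cast h
      exact mul_pos (by linarith) (by linarith)

lemma continuousOn_weightedPsiG {w : ℕ → ℝ} (h0 : ∀ n, 0 ≤ w n) (h1 : ∀ n, w n ≤ 1) (M : ℝ)
    (j : ℕ) : ContinuousOn (weightedPsiG w) (Set.Ioo (zeroLo j) (zeroHi M j)) := by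
  intro x hx
  obtain ⟨p, hp⟩ := exists_between hx.1
  obtain ⟨q, hq⟩ := exists_between hx.2
  have hc : ContinuousAt (poleSum w) x := continuousAt_poleSum h0 h1
    (fun n => Or.inr (mul_pos_of_mem_zeroInterval (M := M) (j := j) ⟨hp.1, hp.2.trans hx.2⟩
      ⟨hx.1.trans hq.1, hq.2⟩ n)) ⟨hp.2, hq.1⟩
  unfold weightedPsiG
  exact ContinuousAt.continuousWithinAt (by fun_prop)

lemma continuousAt_weightedPsiG {w : ℕ → ℝ} (h0 : ∀ n, 0 ≤ w n) (h1 : ∀ n, w n ≤ 1) {x : ℝ}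
    (hx : 0 < x) : ContinuousAt (weightedPsiG w) x := by
  have hc : ContinuousAt (poleSum w) x := continuousAt_poleSum h0 h1 (p := x / 2) (q := x + 1)
    (fun n => Or.inr (by positivity)) ⟨by linarith, by linarith⟩
  unfold weightedPsiG
  fun_prop

lemma hasSum_one_div_mul_succ : HasSum (fun n : ℕ => 1 / (((n : ℝ) + 1) * (n + 2))) 1 := by
  have hs : Summable (fun n : ℕ => 1 / (((n : ℝ) + 1) * (n + 2))) := by
    simpa [add_comm] using summable_poleSum (w := 1) (fun _ => zero_le_one) (fun _ => le_rfl) 2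
  rw [hs.hasSum_iff_tendsto_nat]
  have h := (tendsto_one_div_add_atTop_nhds_zero_nat (𝕜 := ℝ)).const_sub 1
  rw [sub_zero] at h
  refine h.congr fun N => ?_
  induction N with
  | zero => simp
  | succ N ih =>
    rw [Finset.sum_range_succ, ← ih]
    push_cast
    field_simp
    ring

lemma weightedPsiG_one_pos (w : ℕ → ℝ) : 0 < weightedPsiG w 1 := by
  rw [weightedPsiG]
  linarith [log_two_pi_mem.1]

lemma weightedPsiG_two_neg {w : ℕ → ℝ} (h0 : ∀ n, 0 ≤ w n) (h1 : ∀ n, w n ≤ 1) :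
    weightedPsiG w 2 < 0 := by
  have hle : poleSum w 2 ≤ 1 := by
    rw [← hasSum_one_div_mul_succ.tsum_eq, poleSum]
    refine (summable_poleSum h0 h1 2).tsum_le_tsum (fun n => ?_) hasSum_one_div_mul_succ.summable
    rw [add_comm (2 : ℝ)]
    gcongr
    exact h1 n
  rw [weightedPsiG]
  linarith [log_two_pi_mem.2, Real.one_half_lt_eulerMascheroniConstant]

lemma crossesDown_weightedPsiG {w : ℕ → ℝ} (h0 : ∀ n, 0 ≤ w n) (h1 : ∀ n, w n ≤ 1) {M : ℝ}
    (hM : 2 < M) (hFM : 0 < weightedPsiG w M) {j : ℕ} (hj : ∀ n < j, w n = 1) :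
    CrossesDown (fun x => zeroSign j * weightedPsiG w x) (zeroLo j) (zeroHi M j) := by
  have hcont : ContinuousOn (fun x => zeroSign j * weightedPsiG w x)
      (Set.Ioo (zeroLo j) (zeroHi M j)) := (continuousOn_weightedPsiG h0 h1 M j).const_mul _
  have h2 := (continuousAt_weightedPsiG h0 h1 two_pos).eventually
    (gt_mem_nhds (weightedPsiG_two_neg h0 h1))
  match j, hj, hcont with
  | 0, _, hcont =>
    refine ⟨hM, hcont, ?_, ?_⟩
    · filter_upwards [h2.filter_mono nhdsWithin_le_nhds] with x hx
      simpa [zeroSign] using hx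
    · have h := (continuousAt_weightedPsiG h0 h1 (two_pos.trans hM)).eventually (lt_mem_nhds hFM)
      filter_upwards [h.filter_mono nhdsWithin_le_nhds] with x hx
      simpa [zeroSign] using hx
  | 1, _, hcont =>
    refine ⟨one_lt_two, hcont, ?_, ?_⟩
    · have h := (continuousAt_weightedPsiG h0 h1 one_pos).eventually
        (lt_mem_nhds (weightedPsiG_one_pos w))
      filter_upwards [h.filter_mono nhdsWithin_le_nhds] with x hx
      simpa [zeroSign] using hx
    · filter_upwards [h2.filter_mono nhdsWithin_le_nhds] with x hx
      simpa [zeroSign] using hx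
  | k + 2, hj, hcont =>
    refine ⟨by simp [zeroLo, zeroHi], hcont, ?_, ?_⟩
    · have h := eventually_mul_weightedPsiG_pos h0 h1 (hj (k + 1) (by lia))
      push_cast at h
      filter_upwards [h.filter_mono (nhdsWithin_mono _ fun x hx => ne_of_gt hx),
        self_mem_nhdsWithin] with x hx hlt
      have hlt' : -((k : ℝ) + 1) < x := hlt
      simpa [zeroSign] using pos_of_mul_pos_right hx (by linarith)
    · have h := eventually_mul_weightedPsiG_pos h0 h1 (hj k (by lia))
      filter_upwards [h.filter_mono (nhdsWithin_mono _ fun x hx => ne_of_lt hx),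
        self_mem_nhdsWithin] with x hx hlt
      have hlt' : x < -(k : ℝ) := hlt
      simpa [zeroSign] using neg_of_mul_pos_right hx (by linarith)

lemma exists_zero_weightedPsiG {w : ℕ → ℝ} (h0 : ∀ n, 0 ≤ w n) (h1 : ∀ n, w n ≤ 1) {M : ℝ}
    (hM : 2 < M) (hFM : 0 < weightedPsiG w M) {j : ℕ} (hj : ∀ n < j, w n = 1) :
    ∃ z ∈ Set.Ioo (zeroLo j) (zeroHi M j), weightedPsiG w z = 0 := by
  obtain ⟨z, hz, h⟩ := (crossesDown_weightedPsiG h0 h1 hM hFM hj).exists_zero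
  exact ⟨z, hz, (mul_eq_zero.1 h).resolve_left (zeroSign_ne_zero j)⟩

lemma eq_of_mem_zeroInterval {w : ℕ → ℝ} (h0 : ∀ n, 0 ≤ w n) (h1 : ∀ n, w n ≤ 1) (hw : w 0 = 1)
    {M : ℝ} (hM : 2 < M) (hFM : 0 < weightedPsiG w M) {j : ℕ} {y z : ℝ}
    (hy : y ∈ Set.Ioo (zeroLo j) (zeroHi M j)) (hz : z ∈ Set.Ioo (zeroLo j) (zeroHi M j))
    (hFy : weightedPsiG w y = 0) (hFz : weightedPsiG w z = 0) : y = z := by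
  obtain ⟨b, hb, hFb⟩ := exists_zero_weightedPsiG h0 h1 hM hFM (j := 0) (by simp)
  obtain ⟨c, hc, hFc⟩ := exists_zero_weightedPsiG h0 h1 hM hFM (j := 1) (by simpa using hw)
  have hyz := mul_pos_of_mem_zeroInterval hy hz
  match j, hy, hz with
  | 0, hy, hz =>
    simp only [zeroLo, zeroHi, Set.mem_Ioo] at hb hc hy hz
    exact weightedPsiG_zero_unique h0 h1 hw (by linarith) hyz (by linarith) (by linarith) hFc hFy hFz
  | 1, hy, hz =>
    simp only [zeroLo, zeroHi, Set.mem_Ioo] at hb hc hy hz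
    exact weightedPsiG_zero_unique h0 h1 hw (by linarith) hyz (by linarith) (by linarith) hFb hFy hFz
  | k + 2, hy, hz =>
    simp only [zeroLo, zeroHi, Set.mem_Ioo] at hb hc hy hz
    have := k.cast_nonneg (α := ℝ)
    exact weightedPsiG_zero_unique h0 h1 hw (by linarith) hyz (by linarith) (by linarith) hFb hFy hFz

section Truncation

open Polynomial

lemma coeff_prod_one_add_C_mul_X (s : Finset ℕ) (a : ℕ → ℝ) :
    (∏ i ∈ s, (1 + C (a i) * X)).coeff 0 = 1 ∧
    (∏ i ∈ s, (1 + C (a i) * X)).coeff 1 = ∑ i ∈ s, a i ∧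
    2 * (∏ i ∈ s, (1 + C (a i) * X)).coeff 2 = (∑ i ∈ s, a i) ^ 2 - ∑ i ∈ s, a i ^ 2 := by
  induction s using Finset.induction_on with
  | empty => simp [coeff_one]
  | insert i s hi ih =>
    obtain ⟨e0, e1, e2⟩ := ih
    rw [Finset.prod_insert hi, Finset.sum_insert hi, Finset.sum_insert hi, add_mul, one_mul, mul_assoc]
    simp only [coeff_add, coeff_C_mul, coeff_X_mul_zero, coeff_X_mul, e0]
    rw [mul_add, e1, e2]
    refine ⟨by ring, by ring, by ring⟩

lemma natDegree_prod_one_add_C_mul_X_le (s : Finset ℕ) (a : ℕ → ℝ) :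
    (∏ i ∈ s, (1 + C (a i) * X)).natDegree ≤ s.card := by
  refine (natDegree_prod_le _ _).trans ((Finset.sum_le_card_nsmul _ _ 1 fun i _ => ?_).trans_eq ?_)
  · compute_degree
  · simp

/-- A polynomial of degree at most `|s|` with constant term `1` is determined by nonzero roots. -/
lemma eq_prod_of_eval_eq_zero {p : ℝ[X]} {s : Finset ℕ} {r : ℕ → ℝ} (hr : Set.InjOn r s)
    (h0 : ∀ j ∈ s, r j ≠ 0) (hp0 : p.coeff 0 = 1) (hdeg : p.natDegree ≤ s.card)
    (hroot : ∀ j ∈ s, p.eval (r j) = 0) :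
    p = ∏ j ∈ s, (1 + C (-1 / r j) * X) := by
  classical
  have hnot : (0 : ℝ) ∉ s.image r := by
    simp only [Finset.mem_image, not_exists, not_and]
    exact h0
  refine eq_of_degree_sub_lt_of_eval_finset_eq (insert 0 (s.image r)) ?_ fun x hx => ?_
  · rw [Finset.card_insert_of_notMem hnot, Finset.card_image_of_injOn hr]
    refine degree_le_natDegree.trans_lt ?_
    exact_mod_cast Nat.lt_succ_of_le ((natDegree_sub_le _ _).trans
      (max_le hdeg (natDegree_prod_one_add_C_mul_X_le _ _)))
  · rcases Finset.mem_insert.1 hx with rfl | hx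
    · rw [← coeff_zero_eq_eval_zero, ← coeff_zero_eq_eval_zero, hp0,
        (coeff_prod_one_add_C_mul_X s _).1]
    · obtain ⟨j, hj, rfl⟩ := Finset.mem_image.1 hx
      rw [hroot j hj, eval_prod, Finset.prod_eq_zero hj]
      simp [h0 j hj]

lemma sum_inv_sq_eq_coeff {p : ℝ[X]} {s : Finset ℕ} {r : ℕ → ℝ} (hr : Set.InjOn r s)
    (h0 : ∀ j ∈ s, r j ≠ 0) (hp0 : p.coeff 0 = 1) (hdeg : p.natDegree ≤ s.card)
    (hroot : ∀ j ∈ s, p.eval (r j) = 0) :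
    ∑ j ∈ s, 1 / r j ^ 2 = p.coeff 1 ^ 2 - 2 * p.coeff 2 := by
  obtain ⟨-, e1, e2⟩ := coeff_prod_one_add_C_mul_X s fun j => -1 / r j
  rw [eq_prod_of_eval_eq_zero hr h0 hp0 hdeg hroot, e1, e2, sub_sub_cancel]
  exact Finset.sum_congr rfl fun j _ => by rw [div_pow, neg_one_sq]

/-- The weights that keep the poles `0, -1, …, -N`. -/
noncomputable def truncWeight (N n : ℕ) : ℝ := if n ≤ N then 1 else 0

lemma truncWeight_nonneg (N n : ℕ) : 0 ≤ truncWeight N n := by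
  unfold truncWeight
  split_ifs <;> norm_num

lemma truncWeight_le_one (N n : ℕ) : truncWeight N n ≤ 1 := by
  unfold truncWeight
  split_ifs <;> norm_num

lemma truncWeight_of_le {N n : ℕ} (h : n ≤ N) : truncWeight N n = 1 := if_pos h

lemma poleSum_truncWeight (N : ℕ) (x : ℝ) :
    poleSum (truncWeight N) x = ∑ n ∈ Finset.range (N + 1), 1 / ((n + 1) * (x + n)) := by
  rw [poleSum, tsum_eq_sum (s := Finset.range (N + 1))]
  · refine Finset.sum_congr rfl fun n hn => ?_
    rw [truncWeight_of_le (Nat.lt_succ_iff.1 (Finset.mem_range.1 hn))]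
  · intro n hn
    rw [truncWeight, if_neg (by simpa [Nat.lt_succ_iff] using hn), zero_div]

lemma tendsto_weightedPsiG_truncWeight (x : ℝ) :
    Tendsto (fun N => weightedPsiG (truncWeight N) x) atTop (𝓝 (weightedPsiG 1 x)) := by
  have h := (summable_poleSum (w := 1) (fun _ => zero_le_one) (fun _ => le_rfl) x).hasSum
  have h' := h.tendsto_sum_nat.comp (tendsto_add_atTop_nat 1)
  simp only [weightedPsiG, poleSum_truncWeight]
  exact (h'.const_mul _).const_add _

/-- The product of the linear factors vanishing at `-1, …, -N`, normalized at the origin. -/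
noncomputable def poleProd (N : ℕ) : ℝ[X] := ∏ i ∈ Finset.range N, (1 + C (1 / ((i : ℝ) + 1)) * X)

/-- The quotient of `poleProd N` by `X + (i + 1)`. -/
noncomputable def poleProdDiv (N i : ℕ) : ℝ[X] :=
  C (1 / ((i : ℝ) + 1)) * ∏ m ∈ (Finset.range N).erase i, (1 + C (1 / ((m : ℝ) + 1)) * X)

lemma add_mul_poleProdDiv {N i : ℕ} (hi : i ∈ Finset.range N) :
    X * poleProdDiv N i + C ((i : ℝ) + 1) * poleProdDiv N i = poleProd N := by
  have h : (C ((i : ℝ) + 1) * C (1 / ((i : ℝ) + 1)) : ℝ[X]) = 1 := by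
    rw [← C_mul, mul_one_div_cancel (by positivity), C_1]
  rw [poleProd, ← Finset.mul_prod_erase _ _ hi, poleProdDiv]
  linear_combination (∏ m ∈ (Finset.range N).erase i, (1 + C (1 / ((m : ℝ) + 1)) * X)) * h

/-- The numerator of the truncation of `ψ_G`. -/
noncomputable def truncNumerator (N : ℕ) : ℝ[X] :=
  (C ((Real.log (2 * Real.pi) - 1) / 2 + (1 + Real.eulerMascheroniConstant)) -
      C (1 + Real.eulerMascheroniConstant) * X) * (X * poleProd N) +
    (X - 1) ^ 2 * (poleProd N +
      X * ∑ i ∈ Finset.range N, C (1 / ((i : ℝ) + 2)) * poleProdDiv N i)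

lemma natDegree_truncNumerator_le (N : ℕ) : (truncNumerator N).natDegree ≤ N + 2 := by
  have hQ : (poleProd N).natDegree ≤ N := by
    simpa [poleProd] using natDegree_prod_one_add_C_mul_X_le (Finset.range N) fun i => 1 / ((i : ℝ) + 1)
  have hR (i : ℕ) (hi : i ∈ Finset.range N) :
      (C (1 / ((i : ℝ) + 2)) * poleProdDiv N i).natDegree ≤ N - 1 := by
    refine (natDegree_C_mul_le _ _).trans ((natDegree_C_mul_le _ _).trans ?_)
    simpa [Finset.card_erase_of_mem hi] using natDegree_prod_one_add_C_mul_X_le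
      ((Finset.range N).erase i) fun i => 1 / ((i : ℝ) + 1)
  have hS : (X * ∑ i ∈ Finset.range N, C (1 / ((i : ℝ) + 2)) * poleProdDiv N i).natDegree ≤ N := by
    rcases N with - | N
    · simp
    · refine natDegree_mul_le.trans ?_
      have := natDegree_sum_le_of_forall_le _ _ hR
      rw [natDegree_X]
      lia
  unfold truncNumerator
  refine natDegree_add_le_of_degree_le ?_ ?_
  · refine (natDegree_mul_le_of_le (m := 1) (n := N + 1) ?_ ?_).trans (by lia)
    · compute_degree
    · exact (natDegree_mul_le_of_le natDegree_X_le hQ).trans (by lia)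
  · refine (natDegree_mul_le_of_le (m := 2) (n := N) ?_ ?_).trans (by lia)
    · compute_degree
    · exact natDegree_add_le_of_degree_le hQ hS

lemma eval_truncNumerator (N : ℕ) {x : ℝ} (hx : ∀ n : ℕ, x + n ≠ 0) :
    (truncNumerator N).eval x = x * (poleProd N).eval x * weightedPsiG (truncWeight N) x := by
  have hx0 : x ≠ 0 := by simpa using hx 0
  have hdiv (i : ℕ) (hi : i ∈ Finset.range N) :
      (C (1 / ((i : ℝ) + 2)) * poleProdDiv N i).eval x =
        (poleProd N).eval x * (1 / (((i + 1 : ℕ) + 1) * (x + (i + 1 : ℕ)))) := by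
    rw [← add_mul_poleProdDiv hi]
    have h1 : x + ((i : ℝ) + 1) ≠ 0 := by exact_mod_cast hx (i + 1)
    have h2 : (i : ℝ) + 1 + 1 ≠ 0 := by positivity
    have h3 : (i : ℝ) + 2 ≠ 0 := by positivity
    simp only [eval_mul, eval_add, eval_C, eval_X]
    push_cast
    field_simp
    ring
  have hsum : (∑ i ∈ Finset.range N, C (1 / ((i : ℝ) + 2)) * poleProdDiv N i).eval x =
      (poleProd N).eval x *
        ∑ i ∈ Finset.range N, 1 / (((i + 1 : ℕ) + 1) * (x + (i + 1 : ℕ))) := by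
    rw [eval_finsetSum, Finset.sum_congr rfl hdiv, Finset.mul_sum]
  rw [truncNumerator, weightedPsiG, poleSum_truncWeight, Finset.sum_range_succ']
  simp only [eval_mul, eval_add, eval_sub, eval_C, eval_X, eval_pow, eval_one, hsum]
  generalize (∑ i ∈ Finset.range N, 1 / (((i + 1 : ℕ) + 1) * (x + (i + 1 : ℕ))) : ℝ) = T
  simp only [Nat.cast_zero, zero_add, add_zero, one_mul]
  field_simp
  ring

lemma coeff_poleProdDiv {N i : ℕ} (hi : i ∈ Finset.range N) :
    (poleProdDiv N i).coeff 0 = 1 / ((i : ℝ) + 1) ∧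
    (poleProdDiv N i).coeff 1 =
      1 / ((i : ℝ) + 1) * (poleProd N).coeff 1 - 1 / ((i : ℝ) + 1) ^ 2 := by
  have e := add_mul_poleProdDiv hi
  have e0 := congrArg (coeff · 0) e
  have e1 := congrArg (coeff · 1) e
  have hQ : (poleProd N).coeff 0 = 1 := (coeff_prod_one_add_C_mul_X _ _).1
  simp only [coeff_add, coeff_X_mul_zero, coeff_C_mul, hQ] at e0
  simp only [coeff_add, coeff_C_mul, coeff_X_mul _ 0] at e1
  have h : (i : ℝ) + 1 ≠ 0 := by positivity
  have h0 : (poleProdDiv N i).coeff 0 = 1 / ((i : ℝ) + 1) := by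
    field_simp
    linarith
  refine ⟨h0, ?_⟩
  rw [h0] at e1
  rw [← e1]
  field_simp
  ring

lemma coeff_truncNumerator (N : ℕ) :
    (truncNumerator N).coeff 0 = 1 ∧
    (truncNumerator N).coeff 1 ^ 2 - 2 * (truncNumerator N).coeff 2 =
      ((Real.log (2 * Real.pi) - 1) / 2 + (1 + Real.eulerMascheroniConstant) +
        ∑ i ∈ Finset.range N, 1 / (((i : ℝ) + 1) * (i + 2)) - 2) ^ 2 +
      3 * ∑ i ∈ Finset.range N, 1 / ((i : ℝ) + 1) ^ 2 +
      2 * ∑ i ∈ Finset.range N, 1 / (((i : ℝ) + 1) * (i + 2)) +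
      2 * (1 + Real.eulerMascheroniConstant) - 2 := by
  obtain ⟨q0, q1, q2⟩ := coeff_prod_one_add_C_mul_X (Finset.range N) fun i => 1 / ((i : ℝ) + 1)
  rw [← poleProd] at q0 q1 q2
  rw [← q1] at q2
  simp only [one_div_pow] at q2
  set S := ∑ i ∈ Finset.range N, C (1 / ((i : ℝ) + 2)) * poleProdDiv N i with hS
  have s0 : S.coeff 0 = ∑ i ∈ Finset.range N, 1 / (((i : ℝ) + 1) * (i + 2)) := by
    rw [hS, finsetSum_coeff]
    refine Finset.sum_congr rfl fun i hi => ?_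
    rw [coeff_C_mul, (coeff_poleProdDiv hi).1, one_div_mul_one_div, mul_comm]
  have s1 : S.coeff 1 = (poleProd N).coeff 1 * S.coeff 0 -
      (∑ i ∈ Finset.range N, 1 / ((i : ℝ) + 1) ^ 2 - S.coeff 0) := by
    rw [s0, hS, finsetSum_coeff, Finset.mul_sum, ← Finset.sum_sub_distrib,
      ← Finset.sum_sub_distrib]
    refine Finset.sum_congr rfl fun i hi => ?_
    rw [coeff_C_mul, (coeff_poleProdDiv hi).2]
    field_simp
    ring
  rw [← s0]
  have hP : truncNumerator N =
      C ((Real.log (2 * Real.pi) - 1) / 2 + (1 + Real.eulerMascheroniConstant)) * (X * poleProd N) -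
      C (1 + Real.eulerMascheroniConstant) * (X * (X * poleProd N)) +
      (X * (X * (poleProd N + X * S)) - C 2 * (X * (poleProd N + X * S)) +
        (poleProd N + X * S)) := by
    rw [truncNumerator, ← hS]
    simp only [map_ofNat]
    ring
  have c0 : (truncNumerator N).coeff 0 = 1 := by
    rw [hP]
    simp [mul_coeff_zero, q0]
  have c1 : (truncNumerator N).coeff 1 =
      (Real.log (2 * Real.pi) - 1) / 2 + (1 + Real.eulerMascheroniConstant) +
      (poleProd N).coeff 1 + S.coeff 0 - 2 := by
    rw [hP]
    simp only [coeff_add, coeff_sub, coeff_C_mul, coeff_X_mul _ 0, coeff_X_mul_zero, q0]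
    ring
  have c2 : (truncNumerator N).coeff 2 =
      ((Real.log (2 * Real.pi) - 1) / 2 + (1 + Real.eulerMascheroniConstant)) *
        (poleProd N).coeff 1 - (1 + Real.eulerMascheroniConstant) + 1 -
      2 * ((poleProd N).coeff 1 + S.coeff 0) + (poleProd N).coeff 2 + S.coeff 1 := by
    rw [hP]
    simp only [coeff_add, coeff_sub, coeff_C_mul, coeff_X_mul _ 0, coeff_X_mul _ 1,
      coeff_X_mul_zero, q0]
    ring
  refine ⟨c0, ?_⟩
  rw [c1, c2, s1]
  linear_combination -q2

/-- The sum of the inverse squares of the zeros of a truncation of `ψ_G`. -/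
lemma sum_inv_sq_zeros_truncWeight {N : ℕ} {r : ℕ → ℝ}
    (hr : Set.InjOn r (Finset.range (N + 2)))
    (hpole : ∀ j ∈ Finset.range (N + 2), ∀ n : ℕ, r j + n ≠ 0)
    (hzero : ∀ j ∈ Finset.range (N + 2), weightedPsiG (truncWeight N) (r j) = 0) :
    ∑ j ∈ Finset.range (N + 2), 1 / r j ^ 2 =
      ((Real.log (2 * Real.pi) - 1) / 2 + (1 + Real.eulerMascheroniConstant) +
        ∑ i ∈ Finset.range N, 1 / (((i : ℝ) + 1) * (i + 2)) - 2) ^ 2 +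
      3 * ∑ i ∈ Finset.range N, 1 / ((i : ℝ) + 1) ^ 2 +
      2 * ∑ i ∈ Finset.range N, 1 / (((i : ℝ) + 1) * (i + 2)) +
      2 * (1 + Real.eulerMascheroniConstant) - 2 := by
  rw [← (coeff_truncNumerator N).2]
  refine sum_inv_sq_eq_coeff hr (fun j hj => by simpa using hpole j hj 0)
    (coeff_truncNumerator N).1 ?_ fun j hj => ?_
  · simpa using natDegree_truncNumerator_le N
  · rw [eval_truncNumerator N (hpole j hj), hzero j hj, mul_zero]

end Truncation

lemma exists_two_lt_weightedPsiG_pos : ∃ M : ℝ, 2 < M ∧ 0 < weightedPsiG 1 M := by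
  have hlog : Tendsto (fun n : ℕ => Real.log (n + 1 : ℕ)) atTop atTop :=
    Real.tendsto_log_atTop.comp (tendsto_natCast_atTop_atTop.comp (tendsto_add_atTop_nat 1))
  obtain ⟨n, hn, hn2⟩ := ((hlog.eventually_ge_atTop (4 * (1 + Real.eulerMascheroniConstant))).and
    (eventually_gt_atTop 2)).exists
  have hn' : (2 : ℝ) < n := by exact_mod_cast hn2
  refine ⟨n, hn', ?_⟩
  have hH : 4 * (1 + Real.eulerMascheroniConstant) ≤ ∑ i ∈ Finset.range n, 1 / ((i : ℝ) + 1) := by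
    refine (hn.trans (log_add_one_le_harmonic n)).trans_eq ?_
    simp [harmonic]
  have hsum : (∑ i ∈ Finset.range n, 1 / ((i : ℝ) + 1)) * (1 / (2 * n)) ≤ poleSum 1 n := by
    have hs := summable_poleSum (w := 1) (fun _ => zero_le_one) (fun _ => le_rfl) n
    rw [Finset.sum_mul]
    refine (Finset.sum_le_sum fun i hi => ?_).trans
      (hs.sum_le_tsum (Finset.range n) fun i _ => by simp only [Pi.one_apply]; positivity)
    have : (i : ℝ) < n := by exact_mod_cast Finset.mem_range.1 hi
    rw [one_div_mul_one_div, Pi.one_apply]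
    gcongr
    linarith
  have hκ : 0 < 1 + Real.eulerMascheroniConstant := by
    linarith [Real.one_half_lt_eulerMascheroniConstant]
  have h1 : (n - 1 : ℝ) * (1 + Real.eulerMascheroniConstant) ≤ (n - 1) ^ 2 * poleSum 1 n := by
    have h2 : 4 * (1 + Real.eulerMascheroniConstant) * (1 / (2 * n)) ≤ poleSum 1 n :=
      (mul_le_mul_of_nonneg_right hH (by positivity)).trans hsum
    have h3 : (1 + Real.eulerMascheroniConstant) ≤ (n - 1) * poleSum 1 n := by
      refine le_trans ?_ (mul_le_mul_of_nonneg_left h2 (by linarith))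
      rw [mul_one_div, ← mul_div_assoc, le_div_iff₀ (by positivity)]
      nlinarith
    nlinarith
  rw [weightedPsiG]
  linarith [log_two_pi_mem.1]

lemma zeroHi_le_zeroLo {M : ℝ} {i j : ℕ} (h : i < j) : zeroHi M j ≤ zeroLo i := by
  match i, j, h with
  | 0, 1, _ => exact le_rfl
  | 0, k + 2, _ =>
    simp only [zeroHi, zeroLo]
    linarith [k.cast_nonneg (α := ℝ)]
  | 1, k + 2, _ =>
    simp only [zeroHi, zeroLo]
    linarith [k.cast_nonneg (α := ℝ)]
  | l + 2, k + 2, h =>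
    simp only [zeroHi, zeroLo]
    have : (l : ℝ) + 1 ≤ k := by exact_mod_cast (by lia : l + 1 ≤ k)
    linarith

lemma injOn_of_mem_zeroInterval {M : ℝ} {r : ℕ → ℝ} {s : Set ℕ}
    (hr : ∀ j ∈ s, r j ∈ Set.Ioo (zeroLo j) (zeroHi M j)) : Set.InjOn r s := by
  intro i hi j hj hij
  have h1 := hr i hi
  have h2 := hr j hj
  rw [hij] at h1
  rcases lt_trichotomy i j with h | h | h
  · linarith [h1.1, h2.2, zeroHi_le_zeroLo (M := M) h]
  · exact h
  · linarith [h1.2, h2.1, zeroHi_le_zeroLo (M := M) h]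

lemma ne_zero_of_mem_zeroInterval {M : ℝ} {j : ℕ} {x : ℝ}
    (hx : x ∈ Set.Ioo (zeroLo j) (zeroHi M j)) (n : ℕ) : x + n ≠ 0 :=
  left_ne_zero_of_mul (mul_pos_of_mem_zeroInterval hx hx n).ne'

/-- A summable bound for the inverse squares of the zeros, given a bound `C` in `(-1, 0)`. -/
noncomputable def zeroBound (C : ℝ) : ℕ → ℝ
  | 0 => 1
  | 1 => 1
  | 2 => C
  | k + 3 => 1 / (1 + k) ^ 2

lemma summable_zeroBound (C : ℝ) : Summable (zeroBound C) := by
  rw [← summable_nat_add_iff 3]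
  exact summable_one_div_add_nat_sq 1

lemma zeroBound_nonneg {C : ℝ} (hC : 0 ≤ C) (j : ℕ) : 0 ≤ zeroBound C j := by
  match j with
  | 0 | 1 => exact zero_le_one
  | 2 => exact hC
  | k + 3 =>
    unfold zeroBound
    positivity

lemma one_div_sq_le_zeroBound {M C : ℝ} {j : ℕ} {x : ℝ}
    (hx : x ∈ Set.Ioo (zeroLo j) (zeroHi M j)) (hC : j = 2 → 1 / x ^ 2 ≤ C) :
    1 / x ^ 2 ≤ zeroBound C j := by
  match j, hx, hC with
  | 0, hx, _ =>
    have := hx.1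
    simp only [zeroLo] at this
    simp only [zeroBound]
    rw [div_le_one (by positivity)]
    nlinarith
  | 1, hx, _ =>
    have := hx.1
    simp only [zeroLo] at this
    simp only [zeroBound]
    rw [div_le_one (by positivity)]
    nlinarith
  | 2, _, hC => exact hC rfl
  | k + 3, hx, _ =>
    have := hx.2
    simp only [zeroHi] at this
    push_cast at this
    have hk := k.cast_nonneg (α := ℝ)
    simp only [zeroBound]
    exact one_div_le_one_div_of_le (by positivity) (by nlinarith)

/-- The sum of the inverse squares of the zeros of `ψ_G` in the intervals
`(zeroLo j, zeroHi M j)`. -/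
lemma hasSum_inv_sq_zeros {M : ℝ} (hM : 2 < M) (hFM : 0 < weightedPsiG 1 M) {ζ : ℕ → ℝ}
    (hζ : ∀ j, ζ j ∈ Set.Ioo (zeroLo j) (zeroHi M j)) (hζ0 : ∀ j, weightedPsiG 1 (ζ j) = 0) :
    HasSum (fun j => 1 / ζ j ^ 2)
      (((Real.log (2 * Real.pi) - 1) / 2 + Real.eulerMascheroniConstant) ^ 2 + Real.pi ^ 2 / 2 +
        2 * (1 + Real.eulerMascheroniConstant)) := by
  have h0 : ∀ n : ℕ, (0 : ℝ) ≤ (1 : ℕ → ℝ) n := fun _ => zero_le_one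
  have h1 : ∀ n : ℕ, (1 : ℕ → ℝ) n ≤ 1 := fun _ => le_rfl
  have hev : ∀ᶠ N in atTop, 0 < weightedPsiG (truncWeight N) M :=
    (tendsto_weightedPsiG_truncWeight M).eventually (lt_mem_nhds hFM)
  have hex (N j : ℕ) : ∃ z, 0 < weightedPsiG (truncWeight N) M → j < N + 2 →
      z ∈ Set.Ioo (zeroLo j) (zeroHi M j) ∧ weightedPsiG (truncWeight N) z = 0 := by
    by_cases h : 0 < weightedPsiG (truncWeight N) M ∧ j < N + 2
    · obtain ⟨z, hz⟩ := exists_zero_weightedPsiG (truncWeight_nonneg N) (truncWeight_le_one N) hM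
        h.1 (j := j) fun n hn => truncWeight_of_le (by lia)
      exact ⟨z, fun _ _ => hz⟩
    · exact ⟨0, fun h1 h2 => (h ⟨h1, h2⟩).elim⟩
  choose z hz using hex
  have htend (j : ℕ) : Tendsto (fun N => z N j) atTop (𝓝 (ζ j)) := by
    refine (crossesDown_weightedPsiG h0 h1 hM hFM fun _ _ => rfl).tendsto_zero (hζ j)
      (fun y hy h => ?_) (g := fun N x => zeroSign j * weightedPsiG (truncWeight N) x)
      (fun N => (continuousOn_weightedPsiG (truncWeight_nonneg N) (truncWeight_le_one N) M j).const_mul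
        _) ?_ fun x _ => (tendsto_weightedPsiG_truncWeight x).const_mul _
    · exact eq_of_mem_zeroInterval h0 h1 rfl hM hFM hy (hζ j)
        ((mul_eq_zero.1 h).resolve_left (zeroSign_ne_zero j)) (hζ0 j)
    · filter_upwards [hev, eventually_gt_atTop j] with N hN hj y hy h
      obtain ⟨hzN, hzN0⟩ := hz N j hN (by lia)
      exact eq_of_mem_zeroInterval (truncWeight_nonneg N) (truncWeight_le_one N)
        (truncWeight_of_le N.zero_le) hM hN hy hzN
        ((mul_eq_zero.1 h).resolve_left (zeroSign_ne_zero j)) hzN0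
  have htend' (j : ℕ) : Tendsto (fun N => 1 / z N j ^ 2) atTop (𝓝 (1 / ζ j ^ 2)) := by
    have hne : ζ j ≠ 0 := by simpa using ne_zero_of_mem_zeroInterval (hζ j) 0
    exact tendsto_const_nhds.div ((htend j).pow 2) (pow_ne_zero 2 hne)
  set C := 1 / ζ 2 ^ 2 + 1 with hC
  have hCpos : 0 ≤ C := by positivity
  have hsum : Summable fun j => 1 / ζ j ^ 2 :=
    Summable.of_nonneg_of_le (fun j => by positivity)
      (fun j => one_div_sq_le_zeroBound (hζ j) (by rintro rfl; linarith)) (summable_zeroBound C)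
  have hlim : Tendsto (fun N => ∑' j, if j < N + 2 then 1 / z N j ^ 2 else 0) atTop
      (𝓝 (∑' j, 1 / ζ j ^ 2)) := by
    refine tendsto_tsum_of_dominated_convergence (summable_zeroBound C) (fun j => ?_) ?_
    · refine (htend' j).congr' ?_
      filter_upwards [eventually_gt_atTop j] with N hN
      rw [if_pos (by lia)]
    · filter_upwards [hev, (htend' 2).eventually (gt_mem_nhds (lt_add_one _))] with N hN h2 j
      split_ifs with hj
      · rw [Real.norm_of_nonneg (by positivity)]
        exact one_div_sq_le_zeroBound (hz N j hN hj).1 (by rintro rfl; exact h2.le)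
      · rw [norm_zero]
        exact zeroBound_nonneg hCpos j
  have hσ := hasSum_one_div_mul_succ.tendsto_sum_nat
  have hζ2 : Tendsto (fun N => ∑ i ∈ Finset.range N, 1 / ((i : ℝ) + 1) ^ 2) atTop
      (𝓝 (Real.pi ^ 2 / 6)) := by
    have h := (hasSum_nat_add_iff' 1).2 hasSum_zeta_two
    simpa using h.tendsto_sum_nat
  have hform := (((((hσ.const_add ((Real.log (2 * Real.pi) - 1) / 2 +
    (1 + Real.eulerMascheroniConstant))).sub_const 2).pow 2).add (hζ2.const_mul 3)).add
    (hσ.const_mul 2)).add_const (2 * (1 + Real.eulerMascheroniConstant)) |>.sub_const 2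
  have heq := tendsto_nhds_unique hlim (hform.congr' ?_)
  · convert! hsum.hasSum using 1
    rw [heq]
    ring
  · filter_upwards [hev] with N hN
    have hmem : ∀ j ∈ Finset.range (N + 2), z N j ∈ Set.Ioo (zeroLo j) (zeroHi M j) :=
      fun j hj => (hz N j hN (Finset.mem_range.1 hj)).1
    rw [← sum_inv_sq_zeros_truncWeight (injOn_of_mem_zeroInterval (M := M) hmem)
      (fun j hj => ne_zero_of_mem_zeroInterval (hmem j hj))
      fun j hj => (hz N j hN (Finset.mem_range.1 hj)).2, tsum_eq_sum (s := Finset.range (N + 2))]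
    · exact Finset.sum_congr rfl fun j hj => (if_pos (Finset.mem_range.1 hj)).symm
    · exact fun j hj => if_neg (by simpa using hj)

/-- Every real zero of `ψ_G` lies in one of the isolating intervals. -/
lemma exists_eq_zero_of_weightedPsiG_eq_zero {M : ℝ} (hM : 2 < M) (hFM : 0 < weightedPsiG 1 M)
    {ζ : ℕ → ℝ} (hζ : ∀ j, ζ j ∈ Set.Ioo (zeroLo j) (zeroHi M j))
    (hζ0 : ∀ j, weightedPsiG 1 (ζ j) = 0) {x : ℝ} (hx : ∀ n : ℕ, x ≠ -n)
    (hFx : weightedPsiG 1 x = 0) : ∃ j, ζ j = x := by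
  have h0 : ∀ n : ℕ, (0 : ℝ) ≤ (1 : ℕ → ℝ) n := fun _ => zero_le_one
  have h1 : ∀ n : ℕ, (1 : ℕ → ℝ) n ≤ 1 := fun _ => le_rfl
  rcases lt_or_gt_of_ne (by simpa using hx 0 : x ≠ 0) with hneg | hpos
  · have hle := Nat.floor_le (neg_nonneg.2 hneg.le)
    have hlt := Nat.lt_floor_add_one (-x)
    refine ⟨⌊-x⌋₊ + 2, eq_of_mem_zeroInterval h0 h1 rfl hM hFM (hζ _) ⟨?_, ?_⟩ (hζ0 _) hFx⟩
    · simp only [zeroLo]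
      linarith
    · simp only [zeroHi]
      exact lt_of_le_of_ne (by linarith) (hx _)
  · by_cases hx0 : x = ζ 0
    · exact ⟨0, hx0.symm⟩
    · have hζ₀ := (hζ 0).1
      have hζ₁ := hζ 1
      simp only [zeroLo, zeroHi, Set.mem_Ioo] at hζ₀ hζ₁
      have hζ₁pos : 0 < ζ 1 := by linarith
      exact ⟨1, weightedPsiG_zero_unique h0 h1 rfl (by linarith) (fun n => by positivity)
        (by linarith) hx0 (hζ0 0) (hζ0 1) hFx⟩

lemma HasSum.of_range_eq {α : Type*} {f g : ℕ → α} (hf : f.Injective) (hg : g.Injective)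
    (h : Set.range f = Set.range g) {φ : α → ℝ} {a : ℝ} (hs : HasSum (fun n => φ (f n)) a) :
    HasSum (fun n => φ (g n)) a := by
  have h1 : HasSum (fun x : Set.range f => φ x) a :=
    (Equiv.ofInjective f hf).hasSum_iff.1 hs
  rw [h] at h1
  exact (Equiv.ofInjective g hg).hasSum_iff.2 h1

open Real in
/-- `∑_{k=0}^∞ 1/β_k² = 9/4 + π²/2 + γ(1 + γ + log 2π) - (1/2)log 2π + (1/4)log²(2π)`,
where `β` is the strictly decreasing enumeration of the zeros of `ψ_G`. -/
theorem sum_inv_sq_psiG_zeros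
    (β : ℕ → ℝ) (hanti : StrictAnti β)
    (hzero : ∀ k : ℕ, psiG (β k : ℂ) = 0)
    (henum : ∀ x : ℝ, (∀ n : ℕ, x ≠ -(n : ℝ)) → psiG (x : ℂ) = 0 → ∃ k : ℕ, β k = x) :
    Summable (fun k : ℕ => 1 / (β k) ^ 2) ∧
    ∑' k : ℕ, 1 / (β k) ^ 2 =
      9 / 4 + π ^ 2 / 2 +
        eulerMascheroniConstant * (1 + eulerMascheroniConstant + Real.log (2 * π)) -
        (1 / 2) * Real.log (2 * π) + (1 / 4) * (Real.log (2 * π)) ^ 2 := by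
  obtain ⟨M, hM, hFM⟩ := exists_two_lt_weightedPsiG_pos
  choose ζ hζ hζ0 using fun j => exists_zero_weightedPsiG (w := 1) (fun _ => zero_le_one)
    (fun _ => le_rfl) hM hFM (j := j) fun _ _ => rfl
  have hpole (j n : ℕ) : ζ j ≠ -n := fun h =>
    ne_zero_of_mem_zeroInterval (hζ j) n (by rw [h, neg_add_cancel])
  have hβpole (k n : ℕ) : β k ≠ -n := fun h => psiG_neg_natCast_ne_zero n (h ▸ hzero k)
  have hrange : Set.range ζ = Set.range β := by
    ext x
    constructor
    · rintro ⟨j, rfl⟩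
      exact henum _ (hpole j) (by rw [psiG_ofReal (hpole j), hζ0, Complex.ofReal_zero])
    · rintro ⟨k, rfl⟩
      refine exists_eq_zero_of_weightedPsiG_eq_zero hM hFM hζ hζ0 (hβpole k) ?_
      simpa only [psiG_ofReal (hβpole k), Complex.ofReal_eq_zero] using hzero k
  have hinj : ζ.Injective :=
    Set.injOn_univ.1 (injOn_of_mem_zeroInterval (M := M) fun j _ => hζ j)
  have hs := (hasSum_inv_sq_zeros hM hFM hζ hζ0).of_range_eq (φ := fun x => 1 / x ^ 2) hinj
    hanti.injective hrange
  refine ⟨hs.summable, ?_⟩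
  rw [hs.tsum_eq]
  ring
end

section
/- The equation log Γ(x) + x = 1/2 + (1/2)·log(2π) has exactly two solutions x in the positive reals; one solution lies in the interval (0.2909, 0.2910) and the other lies in the interval (1.5376, 1.5377). (These are the two positive critical points of the hyperfactorial function K(x) = Γ(x)^{x−1}/G(x).) -/
open Filter Topology

namespace Real

/-- The remainder `log Γ(x) - ((x - 1/2) log x - x + (1/2) log (2π))` in Stirling's formula. -/
noncomputable def stirlingRemainder (x : ℝ) : ℝ :=
  log (Gamma x) - ((x - 1 / 2) * log x - x + log (2 * π) / 2)

lemma log_Gamma_add_one {x : ℝ} (hx : 0 < x) :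
    log (Gamma (x + 1)) = log (Gamma x) + log x := by
  rw [Gamma_add_one hx.ne', log_mul hx.ne' (Gamma_pos_of_pos hx).ne', add_comm]

lemma log_Gamma_add_nat {x : ℝ} (hx : 0 < x) (n : ℕ) :
    log (Gamma (x + n)) = log (Gamma x) + ∑ m ∈ Finset.range n, log (x + m) := by
  induction n with
  | zero => simp
  | succ n ih =>
    rw [Nat.cast_succ, ← add_assoc, log_Gamma_add_one (by positivity), ih,
      Finset.sum_range_succ, add_assoc]

lemma stirlingRemainder_sub_add_one {x : ℝ} (hx : 0 < x) :
    stirlingRemainder x - stirlingRemainder (x + 1) = (x + 1 / 2) * log ((x + 1) / x) - 1 := by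
  rw [stirlingRemainder, stirlingRemainder, log_Gamma_add_one hx,
    log_div (by positivity) hx.ne']
  ring

lemma tendsto_stirlingRemainder_add_nat {x : ℝ} (hx : 0 < x) :
    Tendsto (fun n : ℕ => stirlingRemainder (x + n)) atTop (𝓝 0) := by
  rw [← tendsto_add_atTop_iff_nat 1]
  have hGamma := BohrMollerup.tendsto_log_gamma hx
  have hStirling := (continuousAt_log (sqrt_pos.2 pi_pos).ne').tendsto.comp
    Stirling.tendsto_stirlingSeq_sqrt_pi
  have hmul := (tendsto_mul_log_one_add_div_atTop (x + 1)).comp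
    (tendsto_natCast_atTop_atTop (R := ℝ))
  have hlog : Tendsto (fun n : ℕ => log (1 + (x + 1) / n)) atTop (𝓝 0) := by
    have h := (tendsto_const_div_atTop_nhds_zero_nat (x + 1)).const_add 1
    rw [add_zero] at h
    simpa [Function.comp_def] using (continuousAt_log one_ne_zero).tendsto.comp h
  have hlim := (((hGamma.const_sub (log (Gamma x))).add
    (hStirling.sub_const (log √π))).add (hmul.const_sub (x + 1))).sub
      (hlog.const_mul (x + 1 / 2))
  simp only [sub_self, mul_zero, add_zero] at hlim
  refine hlim.congr' ?_
  filter_upwards [eventually_gt_atTop 0] with n hn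
  have hn' : (0 : ℝ) < n := by exact_mod_cast hn
  have hquot : 1 + (x + 1) / n = (x + (n + 1 : ℕ)) / n := by
    push_cast
    field_simp
    ring
  simp only [Function.comp_apply]
  rw [stirlingRemainder, log_Gamma_add_nat hx, BohrMollerup.logGammaSeq,
    Stirling.log_stirlingSeq_formula, hquot, log_div (by positivity) hn'.ne',
    log_div hn'.ne' (exp_pos 1).ne', log_exp, log_mul two_ne_zero hn'.ne',
    log_mul two_ne_zero pi_pos.ne', log_sqrt pi_pos.le]
  push_cast
  ring

lemma log_one_add_inv_le {x : ℝ} (hx : 0 < x) :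
    log (1 + x⁻¹) ≤
      2 * (1 / (2 * x + 1)) * (2 / 3 + (1 - (1 / (2 * x + 1)) ^ 2)⁻¹ / 3) := by
  have hz_pos : 0 < 1 / (2 * x + 1) := by positivity
  have hz_lt : 1 / (2 * x + 1) < 1 := by
    rw [div_lt_one (by positivity)]
    linarith
  have h := hasSum_log_one_add_inv hx
  generalize 1 / (2 * x + 1) = z at *
  have hgeom := hasSum_geometric_of_lt_one (sq_nonneg z) (by nlinarith)
  refine hasSum_le (fun k => ?_) h
    (((hasSum_ite_eq 0 (2 / 3 : ℝ)).add (hgeom.div_const 3)).mul_left (2 * z))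
  rcases Nat.eq_zero_or_pos k with rfl | hk
  · norm_num
  · have hk' : (1 : ℝ) ≤ k := by exact_mod_cast hk
    rw [if_neg hk.ne', zero_add, pow_succ, pow_mul]
    have : 1 / (2 * (k : ℝ) + 1) ≤ 1 / 3 := one_div_le_one_div_of_le (by norm_num) (by linarith)
    have hpos : 0 ≤ 2 * z * (z ^ 2) ^ k := by positivity
    nlinarith [mul_le_mul_of_nonneg_left this hpos]

lemma stirlingRemainder_sub_add_one_le {x : ℝ} (hx : 0 < x) :
    stirlingRemainder x - stirlingRemainder (x + 1) ≤ 1 / (12 * x) - 1 / (12 * (x + 1)) := by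
  rw [stirlingRemainder_sub_add_one hx, add_div, div_self hx.ne', one_div x]
  have h := mul_le_mul_of_nonneg_left (log_one_add_inv_le hx)
    (show 0 ≤ x + 1 / 2 by positivity)
  refine (sub_le_sub_right h 1).trans_eq ?_
  have : 1 - (1 / (2 * x + 1)) ^ 2 = 4 * x * (x + 1) / (2 * x + 1) ^ 2 := by
    field_simp
    ring
  rw [this]
  field_simp
  ring

lemma le_stirlingRemainder_sub_add_one {x : ℝ} (hx : 0 < x) :
    (1 / (12 * x) - 1 / (360 * x ^ 3)) - (1 / (12 * (x + 1)) - 1 / (360 * (x + 1) ^ 3)) ≤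
      stirlingRemainder x - stirlingRemainder (x + 1) := by
  have hsum := (hasSum_log_one_add_inv hx).summable.sum_le_tsum (Finset.range 3)
    fun k _ => by positivity
  rw [(hasSum_log_one_add_inv hx).tsum_eq] at hsum
  simp only [Finset.sum_range_succ, Finset.sum_range_zero] at hsum
  rw [stirlingRemainder_sub_add_one hx, add_div, div_self hx.ne', one_div x]
  refine le_trans ?_ (sub_le_sub_right (mul_le_mul_of_nonneg_left hsum
    (show 0 ≤ x + 1 / 2 by positivity)) 1)
  rw [← sub_nonneg]
  have key : 0 ≤ (10 * (x * (x + 1)) ^ 2 + 11 * (x * (x + 1)) + 1) /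
      (360 * (x * (x + 1)) ^ 3 * (2 * x + 1) ^ 4) := by positivity
  refine key.trans_eq ?_
  push_cast
  field_simp
  ring

lemma stirlingRemainder_le {x : ℝ} (hx : 0 < x) : stirlingRemainder x ≤ 1 / (12 * x) := by
  have hmono : Monotone fun n : ℕ => stirlingRemainder (x + n) - 1 / (12 * (x + n)) := by
    refine monotone_nat_of_le_succ fun n => ?_
    have h := stirlingRemainder_sub_add_one_le (show 0 < x + n by positivity)
    push_cast
    rw [← add_assoc]
    linarith
  have hx_top : Tendsto (fun n : ℕ => x + (n : ℝ)) atTop atTop :=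
    tendsto_atTop_add_const_left _ _ tendsto_natCast_atTop_atTop
  have hlim := (tendsto_stirlingRemainder_add_nat hx).sub
    ((hx_top.const_mul_atTop (show (0 : ℝ) < 12 by norm_num)).const_div_atTop 1)
  have h := hmono.ge_of_tendsto hlim 0
  simp only [Nat.cast_zero, add_zero] at h
  linarith

lemma le_stirlingRemainder {x : ℝ} (hx : 0 < x) :
    1 / (12 * x) - 1 / (360 * x ^ 3) ≤ stirlingRemainder x := by
  have hanti : Antitone fun n : ℕ => stirlingRemainder (x + n) -
      (1 / (12 * (x + n)) - 1 / (360 * (x + n) ^ 3)) := by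
    refine antitone_nat_of_succ_le fun n => ?_
    have h := le_stirlingRemainder_sub_add_one (show 0 < x + n by positivity)
    push_cast
    rw [← add_assoc]
    linarith
  have hx_top : Tendsto (fun n : ℕ => x + (n : ℝ)) atTop atTop :=
    tendsto_atTop_add_const_left _ _ tendsto_natCast_atTop_atTop
  have hlim := (tendsto_stirlingRemainder_add_nat hx).sub
    (((hx_top.const_mul_atTop (show (0 : ℝ) < 12 by norm_num)).const_div_atTop 1).sub
      ((((tendsto_pow_atTop three_ne_zero).comp hx_top).const_mul_atTop
        (show (0 : ℝ) < 360 by norm_num)).const_div_atTop 1))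
  have h := hanti.le_of_tendsto hlim 0
  simp only [Nat.cast_zero, add_zero] at h
  linarith

/-- Bounds for `log q`, expanding `artanh z` at `z = (q - 2 ^ k) / (q + 2 ^ k)`. -/
lemma abs_log_sub_artanh_le {q z : ℝ} (k : ℕ) (hq : 0 < q)
    (hz : z = (q - 2 ^ k) / (q + 2 ^ k)) :
    |log q - (k * log 2 + 2 * (z + z ^ 3 / 3 + z ^ 5 / 5 + z ^ 7 / 7))| ≤
      2 * (|z| ^ 9 / (1 - z ^ 2)) := by
  have hk : (0 : ℝ) < 2 ^ k := by positivity
  have hz_abs : |z| < 1 := by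
    rw [hz, abs_lt, lt_div_iff₀ (by positivity), div_lt_one (by positivity)]
    constructor <;> linarith
  obtain ⟨h₁, h₂⟩ := abs_lt.1 hz_abs
  have hq_eq : q = 2 ^ k * ((1 + z) / (1 - z)) := by
    have : 1 - z ≠ 0 := by linarith
    field_simp
    rw [hz]
    field_simp
    ring
  have h := sum_range_sub_log_div_le hz_abs 4
  rw [hq_eq, log_mul hk.ne' (div_pos (by linarith) (by linarith)).ne', log_pow]
  simp only [Finset.sum_range_succ, Finset.sum_range_zero] at h
  norm_num at h
  rw [abs_le] at h ⊢
  constructor <;> linarith [h.1, h.2]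

lemma log_Gamma_add_self_sub_eq {x : ℝ} (hx : 0 < x) :
    log (Gamma x) + x - (1 / 2 + (1 / 2) * log (2 * π)) =
      (x + 7 / 2) * log (x + 4) - 9 / 2 + stirlingRemainder (x + 4) -
        log (x * (x + 1) * (x + 2) * (x + 3)) := by
  have h := log_Gamma_add_nat hx 4
  simp only [Finset.sum_range_succ, Finset.sum_range_zero] at h
  norm_num at h
  have hprod : log (x * (x + 1) * (x + 2) * (x + 3)) =
      log x + log (x + 1) + log (x + 2) + log (x + 3) := by
    rw [log_mul (by positivity) (by positivity), log_mul (by positivity) (by positivity),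
      log_mul (by positivity) (by positivity)]
  rw [stirlingRemainder, h, hprod]
  ring

lemma lt_log_Gamma_add_self_left :
    1 / 2 + (1 / 2) * log (2 * π) < log (Gamma 0.2909) + 0.2909 := by
  have h := log_Gamma_add_self_sub_eq (x := 0.2909) (by norm_num)
  have hr := le_stirlingRemainder (x := 0.2909 + 4) (by norm_num)
  have hy := abs_log_sub_artanh_le (q := 0.2909 + 4) 2 (by norm_num) rfl
  have hP := abs_log_sub_artanh_le (q := 0.2909 * (0.2909 + 1) * (0.2909 + 2) * (0.2909 + 3)) 1
    (by norm_num) rfl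
  rw [← sub_pos, h]
  replace hy := (abs_le.1 hy).1
  replace hP := (abs_le.1 hP).2
  norm_num [abs_of_pos, abs_of_neg] at hr hy hP ⊢
  linarith [log_two_gt_d9, log_two_lt_d9]

lemma log_Gamma_add_self_lt_left :
    log (Gamma 0.2910) + 0.2910 < 1 / 2 + (1 / 2) * log (2 * π) := by
  have h := log_Gamma_add_self_sub_eq (x := 0.2910) (by norm_num)
  have hr := stirlingRemainder_le (x := 0.2910 + 4) (by norm_num)
  have hy := abs_log_sub_artanh_le (q := 0.2910 + 4) 2 (by norm_num) rfl
  have hP := abs_log_sub_artanh_le (q := 0.2910 * (0.2910 + 1) * (0.2910 + 2) * (0.2910 + 3)) 1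
    (by norm_num) rfl
  rw [← sub_neg, h]
  replace hy := (abs_le.1 hy).2
  replace hP := (abs_le.1 hP).1
  norm_num [abs_of_pos, abs_of_neg] at hr hy hP ⊢
  linarith [log_two_gt_d9, log_two_lt_d9]

lemma log_Gamma_add_self_lt_right :
    log (Gamma 1.5376) + 1.5376 < 1 / 2 + (1 / 2) * log (2 * π) := by
  have h := log_Gamma_add_self_sub_eq (x := 1.5376) (by norm_num)
  have hr := stirlingRemainder_le (x := 1.5376 + 4) (by norm_num)
  have hy := abs_log_sub_artanh_le (q := 1.5376 + 4) 2 (by norm_num) rfl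
  have hP := abs_log_sub_artanh_le (q := 1.5376 * (1.5376 + 1) * (1.5376 + 2) * (1.5376 + 3)) 6
    (by norm_num) rfl
  rw [← sub_neg, h]
  replace hy := (abs_le.1 hy).2
  replace hP := (abs_le.1 hP).1
  norm_num [abs_of_pos, abs_of_neg] at hr hy hP ⊢
  linarith [log_two_gt_d9, log_two_lt_d9]

lemma lt_log_Gamma_add_self_right :
    1 / 2 + (1 / 2) * log (2 * π) < log (Gamma 1.5377) + 1.5377 := by
  have h := log_Gamma_add_self_sub_eq (x := 1.5377) (by norm_num)
  have hr := le_stirlingRemainder (x := 1.5377 + 4) (by norm_num)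
  have hy := abs_log_sub_artanh_le (q := 1.5377 + 4) 2 (by norm_num) rfl
  have hP := abs_log_sub_artanh_le (q := 1.5377 * (1.5377 + 1) * (1.5377 + 2) * (1.5377 + 3)) 6
    (by norm_num) rfl
  rw [← sub_pos, h]
  replace hy := (abs_le.1 hy).1
  replace hP := (abs_le.1 hP).2
  norm_num [abs_of_pos, abs_of_neg] at hr hy hP ⊢
  linarith [log_two_gt_d9, log_two_lt_d9]

lemma log_Gamma_strict_sublevel {x y z c : ℝ} (hx : 0 < x) (hxy : x < y) (hyz : y < z)
    (hfx : log (Gamma x) + x ≤ c) (hfz : log (Gamma z) + z ≤ c)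
    (hlt : log (Gamma x) + x < c ∨ log (Gamma z) + z < c) : log (Gamma y) + y < c := by
  have hconv := (convexOn_log_Gamma.add (convexOn_id (convex_Ioi (0 : ℝ)))).2
    (Set.mem_Ioi.2 hx) (Set.mem_Ioi.2 (hx.trans (hxy.trans hyz)))
    (div_nonneg (sub_nonneg.2 hyz.le) (sub_nonneg.2 (hxy.trans hyz).le))
    (div_nonneg (sub_nonneg.2 hxy.le) (sub_nonneg.2 (hxy.trans hyz).le))
    (by rw [← add_div, sub_add_sub_cancel, div_self (by linarith)])
  have : z - x ≠ 0 := by linarith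
  have hcomb : (z - y) / (z - x) * x + (y - x) / (z - x) * z = y := by
    field_simp
    ring
  simp only [smul_eq_mul, Pi.add_apply, Function.comp_apply, id_eq, hcomb] at hconv
  have ha : 0 < (z - y) / (z - x) := div_pos (by linarith) (by linarith)
  have hb : 0 < (y - x) / (z - x) := div_pos (by linarith) (by linarith)
  have hab : (z - y) / (z - x) + (y - x) / (z - x) = 1 := by
    field_simp
    ring
  have hc : (z - y) / (z - x) * c + (y - x) / (z - x) * c = c := by rw [← add_mul, hab, one_mul]
  rcases hlt with hlt | hlt
  · linarith [mul_lt_mul_of_pos_left hlt ha, mul_le_mul_of_nonneg_left hfz hb.le]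
  · linarith [mul_le_mul_of_nonneg_left hfx ha.le, mul_lt_mul_of_pos_left hlt hb]

lemma continuousOn_log_Gamma_add_self :
    ContinuousOn (fun x => log (Gamma x) + x) (Set.Ioi 0) :=
  (differentiableOn_Gamma_Ioi.continuousOn.log fun _ hx => (Gamma_pos_of_pos hx).ne').add
    continuousOn_id

end Real

/-- The equation `log Γ(x) + x = 1/2 + (1/2)log 2π` has exactly two positive real
solutions; one lies in `(0.2909, 0.2910)` and the other in `(1.5376, 1.5377)`.
(These are the two positive critical points of the hyperfactorial
`K(x) = Γ(x)^{x-1}/G(x)`.) -/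
theorem hyperfactorial_critical_points :
    ∃ x₀ x₁ : ℝ,
      x₀ ∈ Set.Ioo (0.2909 : ℝ) 0.2910 ∧
      x₁ ∈ Set.Ioo (1.5376 : ℝ) 1.5377 ∧
      Real.log (Real.Gamma x₀) + x₀ = 1 / 2 + (1 / 2) * Real.log (2 * Real.pi) ∧
      Real.log (Real.Gamma x₁) + x₁ = 1 / 2 + (1 / 2) * Real.log (2 * Real.pi) ∧
      ∀ x : ℝ, 0 < x →
        Real.log (Real.Gamma x) + x = 1 / 2 + (1 / 2) * Real.log (2 * Real.pi) →
        x = x₀ ∨ x = x₁ := by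
  obtain ⟨x₀, ⟨h₀l, h₀r⟩, hx₀⟩ := intermediate_value_Ioo' (show (0.2909 : ℝ) ≤ 0.2910 by norm_num)
    (Real.continuousOn_log_Gamma_add_self.mono
      fun x hx => Set.mem_Ioi.2 (lt_of_lt_of_le (by norm_num) hx.1))
    ⟨Real.log_Gamma_add_self_lt_left, Real.lt_log_Gamma_add_self_left⟩
  obtain ⟨x₁, ⟨h₁l, h₁r⟩, hx₁⟩ := intermediate_value_Ioo (show (1.5376 : ℝ) ≤ 1.5377 by norm_num)
    (Real.continuousOn_log_Gamma_add_self.mono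
      fun x hx => Set.mem_Ioi.2 (lt_of_lt_of_le (by norm_num) hx.1))
    ⟨Real.log_Gamma_add_self_lt_right, Real.lt_log_Gamma_add_self_right⟩
  have hx₀_pos : 0 < x₀ := lt_trans (by norm_num) h₀l
  have hmid := Real.log_Gamma_add_self_lt_left
  have h_mid_x₁ : 0.2910 < x₁ := lt_trans (by norm_num) h₁l
  refine ⟨x₀, x₁, ⟨h₀l, h₀r⟩, ⟨h₁l, h₁r⟩, hx₀, hx₁, fun x hx hfx => ?_⟩
  rcases lt_trichotomy x x₀ with h | h | h
  · exact absurd hx₀ (Real.log_Gamma_strict_sublevel hx h h₀r hfx.le hmid.le (.inr hmid)).ne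
  · exact .inl h
  rcases lt_trichotomy x x₁ with h' | h' | h'
  · rcases lt_trichotomy x 0.2910 with hm | rfl | hm
    · exact absurd hfx (Real.log_Gamma_strict_sublevel hx₀_pos h hm hx₀.le hmid.le (.inr hmid)).ne
    · exact absurd hfx hmid.ne
    · exact absurd hfx (Real.log_Gamma_strict_sublevel (by norm_num) hm h' hmid.le hx₁.le
        (.inl hmid)).ne
  · exact .inr h'
  · exact absurd hx₁ (Real.log_Gamma_strict_sublevel (by norm_num) h_mid_x₁ h' hmid.le hfx.le
      (.inl hmid)).ne
end
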